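/- Let K be a quadratic field and let c ∈ K. The map f_c admits a point α ∈ K of exact period 4 if and only if there exist u, v ∈ K with v² = −u(u²+1)(u²−2u−1) and v(u+1)(u−1) ≠ 0 such that α = (u−1)/(2(u+1)) + v/(2u(u−1)) and c = (u²−4u−1)(u⁴+u³+2u²−u+1)/(4u(u+1)²(u−1)²). Moreover, in this case: (i) the set of all points of K of exact period 4 under f_c is precisely the four-element set {α, f_c(α), f_c²(α), f_c³(α)}, where f_c(α) = −(u+1)/(2(u−1)) + v/(2u(u+1)), f_c²(α) = (u−1)/(2(u+1)) − v/(2u(u−1)), and f_c³(α) = −(u+1)/(2(u−1)) − v/(2u(u+1)); (ii) c ∈ ℚ; and (iii) the nontrivial automorphism σ of K over ℚ satisfies σ(α) = f_c²(α). -/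

import Mathlib

/-- The quadratic map `z ↦ z ^ 2 + c`. -/
def fc {K : Type*} [Field K] (c : K) : K → K := fun z => z ^ 2 + c

/-- `α` has exact period `m` under `fc c`. -/
def HasExactPeriod {K : Type*} [Field K] (c : K) (m : ℕ) (α : K) : Prop :=
  (fc c)^[m] α = α ∧ ∀ j : ℕ, 1 ≤ j → j < m → (fc c)^[j] α ≠ α

/-- `α` has preperiodic type `m_n` under `fc c`: preperiod exactly `n`, eventual period `m`. -/
def HasPreperiodicType {K : Type*} [Field K] (c : K) (m n : ℕ) (α : K) : Prop :=
  HasExactPeriod c m ((fc c)^[n] α) ∧ (fc c)^[n + m - 1] α ≠ (fc c)^[n - 1] α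

set_option maxHeartbeats 1000000 in
theorem halving_exists (s q a b t : ℚ) (hs : s ≠ 0) (hq : q ≠ 0)
    (hr : q ^ 2 + (s ^ 2 - 1) ^ 2 ≠ 0) (hτ : q - (s + 1) ^ 2 ≠ 0)
    (ht : t = (q ^ 2 - (s ^ 2 - 1) ^ 2) / (2 * q))
    (h₁ : a ^ 2 * t + 2 * a * b = -t ^ 4 + 3 * t ^ 2 * s ^ 2 - s ^ 4 + 2 * t ^ 3 - 4 * t * s ^ 2
      + 2 * t + 1)
    (h₂ : b ^ 2 - a ^ 2 * s ^ 2 = t ^ 3 * s ^ 2 - 2 * t * s ^ 4 - 2 * t ^ 2 * s ^ 2 + 2 * s ^ 4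
      - 2 * s ^ 2) :
    ∃ A B C : ℚ, q * C = -(s + 1) ^ 2 * A ∧
      (2 + (s ^ 2 - 1) * A * (q * A - (s ^ 2 - 1) * B) - q * C * ((s ^ 2 - 1) * C - q * B)
        + (s ^ 2 + 1) * q * B * (A - C) = 0) ∧
      ((q * A - (s ^ 2 - 1) * B) ^ 2 + ((s ^ 2 - 1) * C - q * B) ^ 2
        + 2 * ((s ^ 2 - 1) * A) * ((s ^ 2 - 1) * C - q * B)
        + 2 * (q * C) * (q * A - (s ^ 2 - 1) * B)
        + 2 * ((s ^ 2 + 1) * q) * (A ^ 2 + C ^ 2 - B ^ 2 + A * C) = 8) ∧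
      2 * a = -((s ^ 2 - 1) * C - q * B + q * A - (s ^ 2 - 1) * B)
        - (q * A - (s ^ 2 - 1) * B + q * B - (s ^ 2 - 1) * C) * t
        - ((s ^ 2 - 1) * A + q * C) * (t ^ 2 - s ^ 2) := by
  have hs2 : 1 + s ^ 2 ≠ 0 := by positivity
  obtain ⟨xa, hxa⟩ : ∃ xa, xa = 2 * q * (q - (s ^ 2 - 1)) * s /
    ((1 + s ^ 2) * (q ^ 2 + (s ^ 2 - 1) ^ 2) * (q - (s + 1) ^ 2)) := ⟨_, rfl⟩
  obtain ⟨xb, hxb⟩ : ∃ xb, xb = -(q + (s ^ 2 - 1)) * (2 * q - (q - (s ^ 2 - 1)) ^ 2) /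
    (s * (1 + s ^ 2) * (q ^ 2 + (s ^ 2 - 1) ^ 2) * (q - (s + 1) ^ 2)) := ⟨_, rfl⟩
  obtain ⟨w, hw⟩ : ∃ w, w = (s ^ 2 - 1) * ((s ^ 2 + s + 1 + t) / s - (s + 1) ^ 2 / q) := ⟨_, rfl⟩
  obtain ⟨ya, hya⟩ : ∃ ya, ya = (1 + w * xa) / q := ⟨_, rfl⟩
  obtain ⟨yb, hyb⟩ : ∃ yb, yb = ((1 + t) / s ^ 2 + w * xb) / q := ⟨_, rfl⟩
  have quad : ∀ {p₀ p₁ p₂ p₃ : ℚ}, p₁ - p₂ * t + p₃ * s ^ 2 = 0 →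
      p₂ * (-t ^ 4 + 3 * t ^ 2 * s ^ 2 - s ^ 4 + 2 * t ^ 3 - 4 * t * s ^ 2 + 2 * t + 1) +
      p₃ * (t ^ 3 * s ^ 2 - 2 * t * s ^ 4 - 2 * t ^ 2 * s ^ 2 + 2 * s ^ 4 - 2 * s ^ 2) = p₀ →
      p₁ * a ^ 2 + 2 * p₂ * a * b + p₃ * b ^ 2 = p₀ := by
    intro p₀ p₁ p₂ p₃ e₁ e₂
    linear_combination a ^ 2 * e₁ + e₂ + p₂ * h₁ + p₃ * h₂
  clear h₁ h₂
  refine ⟨xa * a + xb * b, ya * a + yb * b, -(s + 1) ^ 2 / q * (xa * a + xb * b), ?_, ?_, ?_, ?_⟩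
  · field_simp
  · obtain ⟨d₁, hd₁⟩ : ∃ d, d = (s ^ 2 - 1) * q - (s ^ 2 - 1) * (s + 1) ^ 4 / q := ⟨_, rfl⟩
    obtain ⟨d₂, hd₂⟩ : ∃ d, d = -(s ^ 2 - 1) ^ 2 - q * (s + 1) ^ 2 +
      (s ^ 2 + 1) * (q + (s + 1) ^ 2) := ⟨_, rfl⟩
    have key := @quad (-2) (d₁ * xa ^ 2 + d₂ * xa * ya)
      (d₁ * xa * xb + d₂ * (xa * yb + xb * ya) / 2) (d₁ * xb ^ 2 + d₂ * xb * yb)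
      (by
        rw [hya, hyb, hw, hxa, hxb, hd₁, hd₂, ht]
        field_simp
        ring)
      (by
        rw [hya, hyb, hw, hxa, hxb, hd₁, hd₂, ht]
        field_simp
        ring)
    rw [hd₁, hd₂] at key
    field_simp at key ⊢
    linear_combination key
  · obtain ⟨d₁, hd₁⟩ : ∃ d, d = q ^ 2 + (s ^ 2 - 1) ^ 2 * (s + 1) ^ 4 / q ^ 2
      - 2 * (s ^ 2 - 1) ^ 2 * (s + 1) ^ 2 / q - 2 * q * (s + 1) ^ 2
      + 2 * (s ^ 2 + 1) * (q + (s + 1) ^ 4 / q - (s + 1) ^ 2) := ⟨_, rfl⟩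
    obtain ⟨d₂, hd₂⟩ : ∃ d, d = -4 * (s ^ 2 - 1) * (q - (s + 1) ^ 2) := ⟨_, rfl⟩
    obtain ⟨d₃, hd₃⟩ : ∃ d, d = (s ^ 2 - 1) ^ 2 + q ^ 2 - 2 * (s ^ 2 + 1) * q := ⟨_, rfl⟩
    have key := @quad 8 (d₁ * xa ^ 2 + d₂ * xa * ya + d₃ * ya ^ 2)
      (d₁ * xa * xb + d₂ * (xa * yb + xb * ya) / 2 + d₃ * ya * yb)
      (d₁ * xb ^ 2 + d₂ * xb * yb + d₃ * yb ^ 2)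
      (by
        rw [hya, hyb, hw, hxa, hxb, hd₁, hd₂, hd₃, ht]
        field_simp
        ring)
      (by
        rw [hya, hyb, hw, hxa, hxb, hd₁, hd₂, hd₃, ht]
        field_simp
        ring)
    rw [hd₁, hd₂, hd₃] at key
    field_simp at key ⊢
    linear_combination key
  · have e1 : 2 = -((s ^ 2 - 1) * (-(s + 1) ^ 2 / q * xa) - q * ya + q * xa - (s ^ 2 - 1) * ya)
        - (q * xa - (s ^ 2 - 1) * ya + q * ya - (s ^ 2 - 1) * (-(s + 1) ^ 2 / q * xa)) * t
        - ((s ^ 2 - 1) * xa + q * (-(s + 1) ^ 2 / q * xa)) * (t ^ 2 - s ^ 2) := by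
      rw [hya, hw, hxa, ht]
      field_simp
      ring
    have e2 : 0 = -((s ^ 2 - 1) * (-(s + 1) ^ 2 / q * xb) - q * yb + q * xb - (s ^ 2 - 1) * yb)
        - (q * xb - (s ^ 2 - 1) * yb + q * yb - (s ^ 2 - 1) * (-(s + 1) ^ 2 / q * xb)) * t
        - ((s ^ 2 - 1) * xb + q * (-(s + 1) ^ 2 / q * xb)) * (t ^ 2 - s ^ 2) := by
      rw [hyb, hw, hxb, ht]
      field_simp
      ring
    linear_combination a * e1 + b * e2

/-- The pair `(x² - t x + n, a x + b)` is the Mumford representation of a divisor on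
`y² = -x (x² + 1) (x² - 2 x - 1)`. -/
def IsMumford (t n a b : ℚ) : Prop :=
  a ^ 2 * t + 2 * a * b = -t ^ 4 + 3 * t ^ 2 * n - n ^ 2 + 2 * t ^ 3 - 4 * t * n + 2 * t + 1 ∧
    b ^ 2 - a ^ 2 * n = t ^ 3 * n - 2 * t * n ^ 2 - 2 * t ^ 2 * n + 2 * n ^ 2 - 2 * n

/-- The last coordinate on the Kummer surface. -/
def kummer (t n a : ℚ) : ℚ := a ^ 2 + t ^ 3 - t * n - 2 * t ^ 2 - 2

/-- The coefficients of
`4 F = ((α x + β) (A x² - B x + C))² + ((β x - α) (C x² + B x + A))²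
  + 2 σ (x² + 1) (A x² - B x + C) (C x² + B x + A)`, where `F = -x (x² + 1) (x² - 2 x - 1)`. -/
structure IsHalving (α β σ A B C : ℚ) : Prop where
  e₀ : α ^ 2 * A ^ 2 + β ^ 2 * C ^ 2 + 2 * σ * A * C = 0
  e₁ : 2 + α * A * (β * A - α * B) - β * C * (α * C - β * B) + σ * B * (A - C) = 0
  e₂ : (β * A - α * B) ^ 2 + (α * C - β * B) ^ 2 + 2 * (α * A) * (α * C - β * B)
    + 2 * (β * C) * (β * A - α * B) + 2 * σ * (A ^ 2 + C ^ 2 - B ^ 2 + A * C) = 8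

namespace IsHalving

variable {α β σ A B C : ℚ}

theorem isMumford (h : IsHalving α β σ A B C) (hA : A ≠ 0) :
    IsMumford (B / A) (C / A) ((A + C) * (β * B ^ 2 + β * A * (A - C) - α * A * B) / (2 * A ^ 2))
      ((A + C) * (-β * B * C - α * A * (A - C)) / (2 * A ^ 2)) := by
  obtain ⟨e₀, e₁, e₂⟩ := h
  have j₁ : (A + C) ^ 2 * ((β * B ^ 2 + β * A * (A - C) - α * A * B) ^ 2 * B
      + 2 * (β * B ^ 2 + β * A * (A - C) - α * A * B) * (-β * B * C - α * A * (A - C)) * A)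
      = 4 * A * (-B ^ 4 + 3 * B ^ 2 * C * A - C ^ 2 * A ^ 2 + 2 * B ^ 3 * A - 4 * B * C * A ^ 2
        + 2 * B * A ^ 3 + A ^ 4) := by
    linear_combination (3 * A ^ 2 * B * C ^ 2 - 4 * A * B ^ 3 * C + B ^ 5) * e₀
      + (-2 * A ^ 5 + 2 * A ^ 3 * C ^ 2 - 6 * A ^ 2 * B ^ 2 * C + 2 * A * B ^ 4) * e₁
      + (A ^ 4 * B - 2 * A ^ 3 * B * C + A ^ 2 * B ^ 3) * e₂
  have j₂ : (A + C) ^ 2 * ((-β * B * C - α * A * (A - C)) ^ 2 * A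
      - (β * B ^ 2 + β * A * (A - C) - α * A * B) ^ 2 * C)
      = 4 * A * (B ^ 3 * C - 2 * B * C ^ 2 * A - 2 * B ^ 2 * C * A + 2 * C ^ 2 * A ^ 2
        - 2 * C * A ^ 3) := by
    linear_combination (A ^ 5 - A ^ 2 * C ^ 3 + 3 * A * B ^ 2 * C ^ 2 - B ^ 4 * C) * e₀
      + (4 * A ^ 2 * B * C ^ 2 - 2 * A * B ^ 3 * C) * e₁
      + (-A ^ 4 * C + A ^ 3 * C ^ 2 - A ^ 2 * B ^ 2 * C) * e₂
  constructor
  · field_simp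
    linear_combination j₁
  · field_simp
    linear_combination j₂

/-- A polynomial expression for the last Kummer coordinate of the half. -/
theorem kummer_eq (h : IsHalving α β σ A B C) (hA : A ≠ 0) (hAC : A + C ≠ 0) {K : ℚ}
    (hK : K = -1 / 2 * α ^ 2 * A ^ 2 * B - 3 / 4 * α ^ 2 * A ^ 2 * C + 1 / 2 * α ^ 2 * A * B ^ 2
      + 1 / 4 * α ^ 2 * B ^ 2 * C + 1 / 4 * α ^ 2 * C ^ 3 + α * β * A ^ 2 * B + α * β * A ^ 2 * C
      - α * β * A * C ^ 2 - 1 / 4 * β ^ 2 * A ^ 3 - 1 / 2 * β ^ 2 * A ^ 2 * C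
      - 1 / 4 * β ^ 2 * A * B ^ 2 + 1 / 4 * β ^ 2 * A * C ^ 2 + 1 / 2 * β ^ 2 * B * C ^ 2
      - σ * A ^ 3 + 2 * A - B - 2 * C) :
    A * kummer (B / A) (C / A)
      ((A + C) * (β * B ^ 2 + β * A * (A - C) - α * A * B) / (2 * A ^ 2)) = K := by
  obtain ⟨e₀, e₁, e₂⟩ := h
  have r : α ^ 2 * A ^ 3 + 2 * α ^ 2 * A ^ 2 * B - α ^ 2 * A * B ^ 2 - α ^ 2 * A * C ^ 2
      - 4 * α * β * A ^ 2 * C + 4 * α * β * A * B * C + 4 * α * β * A * C ^ 2 - β ^ 2 * A ^ 2 * C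
      - β ^ 2 * B ^ 2 * C - 2 * β ^ 2 * B * C ^ 2 + β ^ 2 * C ^ 3 = 0 := by
    apply mul_left_cancel₀ hAC
    linear_combination (A ^ 2 + 2 * A * B + A * C - B ^ 2 - 2 * B * C + C ^ 2) * e₀ + (-4 * A * C) * e₁
    + (-A * C) * e₂
  have h : 4 * A ^ 3 * K = (A + C) ^ 2 * (β * B ^ 2 + β * A * (A - C) - α * A * B) ^ 2
      + 4 * (A * B ^ 3 - A ^ 2 * B * C - 2 * A ^ 2 * B ^ 2 - 2 * A ^ 4) := by
    rw [hK]
    linear_combination (-2 * A ^ 3 * B + A ^ 3 * C + A ^ 2 * B ^ 2 + 4 * A ^ 2 * B * C - 2 * A ^ 2 * C ^ 2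
    + A * B ^ 2 * C - 4 * A * B * C ^ 2 - B ^ 4 + B ^ 2 * C ^ 2 + 2 * B * C ^ 3 - C ^ 4) * e₀
    + (-2 * A ^ 3 * B + 4 * A ^ 3 * C + 2 * A ^ 2 * B * C - 4 * A ^ 2 * C ^ 2 - 2 * A * B ^ 3
    + 4 * A * C ^ 3) * e₁ + (-2 * A ^ 4 + 2 * A ^ 3 * C - A ^ 2 * B ^ 2 - A ^ 2 * C ^ 2
    + A * C ^ 3) * e₂ + (C ^ 3) * r
  unfold kummer
  field_simp
  linear_combination -h

set_option maxHeartbeats 1000000 in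
theorem duplication (h : IsHalving α β σ A B C) (hAC : A + C ≠ 0) {K M : ℚ}
    (hK : K = -1 / 2 * α ^ 2 * A ^ 2 * B - 3 / 4 * α ^ 2 * A ^ 2 * C + 1 / 2 * α ^ 2 * A * B ^ 2
      + 1 / 4 * α ^ 2 * B ^ 2 * C + 1 / 4 * α ^ 2 * C ^ 3 + α * β * A ^ 2 * B + α * β * A ^ 2 * C
      - α * β * A * C ^ 2 - 1 / 4 * β ^ 2 * A ^ 3 - 1 / 2 * β ^ 2 * A ^ 2 * C
      - 1 / 4 * β ^ 2 * A * B ^ 2 + 1 / 4 * β ^ 2 * A * C ^ 2 + 1 / 2 * β ^ 2 * B * C ^ 2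
      - σ * A ^ 3 + 2 * A - B - 2 * C)
    (hM : M = -(A + C) ^ 2 * ((A - C) ^ 2 + B ^ 2) / 2) :
    -A ^ 2 + A * B + 4 * A * C + A * K - B * C + B * K + C ^ 2 + C * K = M * (σ - α * β) ∧
      -4 * A ^ 2 + 2 * A * B - 2 * A * K + 2 * B * C + 4 * C ^ 2 + 2 * C * K = M * (β ^ 2 - α ^ 2) ∧
      A ^ 2 + A * B + 4 * A * C + A * K - B * C - B * K - C ^ 2 + C * K = M * (σ + α * β) ∧
      K ^ 2 + 4 * A * C - B ^ 2 = M * (-1 / 8 * α ^ 4 * A ^ 2 + 1 / 2 * α ^ 4 * A * B - 1 / 4 * α ^ 4 * A * C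
        - 1 / 8 * α ^ 4 * B ^ 2 - 1 / 8 * α ^ 4 * C ^ 2 - α ^ 3 * β * A ^ 2
        - 1 / 2 * α ^ 3 * β * A * B + α ^ 3 * β * A * C + 1 / 2 * α ^ 3 * β * B ^ 2
        + 1 / 2 * α ^ 3 * β * B * C + α ^ 3 * β * C ^ 2 + 9 / 4 * α ^ 2 * β ^ 2 * A ^ 2
        - 3 / 2 * α ^ 2 * β ^ 2 * A * B - 3 / 2 * α ^ 2 * β ^ 2 * A * C
        - 3 / 4 * α ^ 2 * β ^ 2 * B ^ 2 - 5 / 2 * α ^ 2 * β ^ 2 * B * C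
        - 7 / 4 * α ^ 2 * β ^ 2 * C ^ 2 - 3 / 2 * α ^ 2 * σ * A * B + 1 / 2 * α ^ 2 * σ * B ^ 2
        + 1 / 2 * α ^ 2 * σ * B * C + 1 / 2 * α * β ^ 3 * A * B + α * β ^ 3 * A * C
        + 1 / 2 * α * β ^ 3 * B ^ 2 + 7 / 2 * α * β ^ 3 * B * C + 2 * α * β * σ * A ^ 2
        + 2 * α * β * σ * A * B - α * β * σ * B ^ 2 - 2 * α * β * σ * B * C
        - 1 / 8 * β ^ 4 * A ^ 2 - 1 / 4 * β ^ 4 * A * C - 1 / 8 * β ^ 4 * B ^ 2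
        - 1 / 2 * β ^ 4 * B * C - 1 / 8 * β ^ 4 * C ^ 2 - 1 / 2 * β ^ 2 * σ * A * B
        + 1 / 2 * β ^ 2 * σ * B ^ 2 + 3 / 2 * β ^ 2 * σ * B * C + σ ^ 2 * A * B - σ ^ 2 * B * C) := by
  obtain ⟨e₀, e₁, e₂⟩ := h
  have r : α ^ 2 * A ^ 3 + 2 * α ^ 2 * A ^ 2 * B - α ^ 2 * A * B ^ 2 - α ^ 2 * A * C ^ 2
      - 4 * α * β * A ^ 2 * C + 4 * α * β * A * B * C + 4 * α * β * A * C ^ 2 - β ^ 2 * A ^ 2 * C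
      - β ^ 2 * B ^ 2 * C - 2 * β ^ 2 * B * C ^ 2 + β ^ 2 * C ^ 3 = 0 := by
    apply mul_left_cancel₀ hAC
    linear_combination (A ^ 2 + 2 * A * B + A * C - B ^ 2 - 2 * B * C + C ^ 2) * e₀ + (-4 * A * C) * e₁
    + (-A * C) * e₂
  rw [hK, hM]
  refine ⟨?_, ?_, ?_, ?_⟩
  · linear_combination (-3 / 4 * A * B - 1 / 4 * A * C + 3 / 4 * B ^ 2 + 1 / 4 * B * C) * e₀ + (-1 / 2 * A ^ 2
    + A * C - 1 / 2 * B ^ 2 - B * C + 1 / 2 * C ^ 2) * e₁ + (-1 / 4 * A ^ 2 - 1 / 4 * A * B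
    - 1 / 4 * A * C + 1 / 4 * B * C + 1 / 4 * C ^ 2) * e₂ + (-1 / 4 * B) * r
  · linear_combination (-1 / 2 * A ^ 2 + A * B + 1 / 2 * A * C - 1 / 2 * B ^ 2 - B * C + 3 / 2 * C ^ 2) * e₀
    + (2 * A * B - 2 * A * C) * e₁ + (A ^ 2 - 3 / 2 * A * C) * e₂ + (-C) * r
  · linear_combination (-1 / 4 * A * B - 1 / 4 * A * C + 3 / 4 * B ^ 2 + 3 / 4 * B * C) * e₀ + (1 / 2 * A ^ 2 + A * C
    + 1 / 2 * B ^ 2 - B * C - 1 / 2 * C ^ 2) * e₁ + (-1 / 4 * A ^ 2 + 1 / 4 * A * B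
    - 1 / 4 * A * C - 1 / 4 * B * C + 1 / 4 * C ^ 2) * e₂ + (1 / 4 * B) * r
  · linear_combination (-1 / 16 * α ^ 2 * A ^ 4 + 1 / 4 * α ^ 2 * A ^ 3 * B - 5 / 8 * α ^ 2 * A ^ 3 * C
    + 3 / 8 * α ^ 2 * A ^ 2 * B ^ 2 - 1 / 4 * α ^ 2 * A ^ 2 * B * C
    - 1 / 4 * α ^ 2 * A ^ 2 * C ^ 2 - 5 / 8 * α ^ 2 * A * B ^ 3 + 1 / 8 * α ^ 2 * A * B ^ 2 * C
    + 1 / 4 * α ^ 2 * A * B * C ^ 2 + 5 / 16 * α ^ 2 * A * C ^ 3 + 1 / 16 * α ^ 2 * B ^ 4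
    + 5 / 8 * α ^ 2 * B ^ 3 * C + 5 / 16 * α ^ 2 * B ^ 2 * C ^ 2 + 1 / 4 * α ^ 2 * B * C ^ 3
    + 1 / 8 * α ^ 2 * C ^ 4 - 1 / 2 * α * β * A ^ 4 + 5 / 4 * α * β * A ^ 3 * B
    - 1 / 4 * α * β * A ^ 3 * C + 3 / 4 * α * β * A ^ 2 * B ^ 2 - 3 / 4 * α * β * A ^ 2 * B * C
    + 3 / 4 * α * β * A ^ 2 * C ^ 2 + 1 / 4 * α * β * A * B ^ 3 + 1 / 4 * α * β * A * B ^ 2 * C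
    + 1 / 4 * α * β * A * B * C ^ 2 + 1 / 4 * α * β * A * C ^ 3 - 9 / 4 * α * β * B ^ 2 * C ^ 2
    - 1 / 2 * α * β * B * C ^ 3 + 1 / 2 * α * β * C ^ 4 - 1 / 8 * β ^ 2 * A ^ 4
    - 3 / 8 * β ^ 2 * A ^ 3 * B - 3 / 16 * β ^ 2 * A ^ 3 * C - 1 / 8 * β ^ 2 * A ^ 2 * B ^ 2
    - 1 / 4 * β ^ 2 * A ^ 2 * B * C - 3 / 8 * β ^ 2 * A * B ^ 3 + 11 / 16 * β ^ 2 * A * B ^ 2 * C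
    + 1 / 4 * β ^ 2 * A * B * C ^ 2 - 1 / 8 * β ^ 2 * A * C ^ 3 + 3 / 8 * β ^ 2 * B ^ 3 * C
    + 7 / 16 * β ^ 2 * B ^ 2 * C ^ 2 - 1 / 8 * β ^ 2 * B * C ^ 3 - 1 / 16 * β ^ 2 * C ^ 4
    - 1 / 2 * σ * A ^ 4 - 1 / 2 * σ * A ^ 3 * B - 1 / 2 * σ * A ^ 3 * C
    + 1 / 2 * σ * A ^ 2 * B ^ 2 - 3 / 4 * σ * A ^ 2 * B * C + 3 / 4 * σ * A * B ^ 3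
    + 3 / 4 * σ * A * B * C ^ 2 - 3 / 4 * σ * B ^ 3 * C + 1 / 2 * σ * B * C ^ 3 + 2 * A ^ 2
    + 2 * A * B - 2 * B ^ 2 - 2 * B * C) * e₀ + (1 / 2 * α ^ 2 * A ^ 3 * B
    - 1 / 4 * α ^ 2 * A ^ 3 * C + 3 / 4 * α ^ 2 * A ^ 2 * B * C + 3 / 4 * α ^ 2 * A ^ 2 * C ^ 2
    - 1 / 2 * α ^ 2 * A * B ^ 3 + 1 / 4 * α ^ 2 * A * B ^ 2 * C + 1 / 2 * α ^ 2 * A * B * C ^ 2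
    - 1 / 4 * α ^ 2 * B ^ 3 * C - 1 / 2 * α ^ 2 * B ^ 2 * C ^ 2 - 1 / 4 * α ^ 2 * B * C ^ 3
    - 1 / 2 * α ^ 2 * C ^ 4 + α * β * A ^ 4 + α * β * A ^ 3 * B - α * β * A ^ 3 * C
    - α * β * A ^ 2 * B * C - α * β * A ^ 2 * C ^ 2 + 2 * α * β * A * B ^ 2 * C
    - α * β * A * C ^ 3 + α * β * B ^ 2 * C ^ 2 + α * β * B * C ^ 3 + α * β * C ^ 4
    - 1 / 2 * β ^ 2 * A ^ 4 + 1 / 4 * β ^ 2 * A ^ 3 * B - 1 / 2 * β ^ 2 * A ^ 2 * B ^ 2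
    + 1 / 2 * β ^ 2 * A ^ 2 * B * C + 3 / 4 * β ^ 2 * A ^ 2 * C ^ 2 + 1 / 4 * β ^ 2 * A * B ^ 3
    - 3 / 4 * β ^ 2 * A * B * C ^ 2 - 1 / 4 * β ^ 2 * A * C ^ 3 - β ^ 2 * B ^ 2 * C ^ 2
    - 1 / 2 * β ^ 2 * B * C ^ 3 + σ * A ^ 3 * B + σ * A ^ 2 * B ^ 2 + σ * B ^ 2 * C ^ 2
    + 2 * A ^ 2 - 2 * A * B - 2 * A * C + 2 * B * C + 2 * C ^ 2) * e₁ + (1 / 4 * α ^ 2 * A ^ 4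
    + 3 / 8 * α ^ 2 * A ^ 3 * B + 5 / 16 * α ^ 2 * A ^ 3 * C - 3 / 8 * α ^ 2 * A ^ 2 * B ^ 2
    - 1 / 4 * α ^ 2 * A ^ 2 * B * C - 3 / 16 * α ^ 2 * A ^ 2 * C ^ 2
    - 1 / 16 * α ^ 2 * A * B ^ 2 * C - 1 / 8 * α ^ 2 * A * B * C ^ 2 - 1 / 8 * α ^ 2 * A * C ^ 3
    + 1 / 2 * α * β * A ^ 4 - 1 / 2 * α * β * A ^ 3 * B - α * β * A ^ 3 * C
    + 1 / 4 * α * β * A ^ 2 * B ^ 2 + 3 / 4 * α * β * A ^ 2 * B * C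
    + 3 / 4 * α * β * A ^ 2 * C ^ 2 + 1 / 2 * α * β * A * B ^ 2 * C - 1 / 2 * α * β * A * C ^ 3
    + 1 / 4 * α * β * B ^ 2 * C ^ 2 + 1 / 8 * β ^ 2 * A ^ 3 * C + 1 / 4 * β ^ 2 * A ^ 2 * B * C
    + 1 / 16 * β ^ 2 * A ^ 2 * C ^ 2 - 3 / 8 * β ^ 2 * A * B ^ 2 * C
    - 3 / 8 * β ^ 2 * A * B * C ^ 2 + 1 / 16 * β ^ 2 * A * C ^ 3 - 1 / 8 * β ^ 2 * B ^ 2 * C ^ 2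
    + 1 / 8 * β ^ 2 * B * C ^ 3 + 1 / 2 * σ * A ^ 4 + 1 / 4 * σ * A ^ 3 * B
    - 1 / 4 * σ * B * C ^ 3) * e₂ + (1 / 16 * α ^ 2 * B ^ 2 * C + 1 / 8 * α ^ 2 * B * C ^ 2
    - 1 / 4 * α * β * B * C ^ 2 - 1 / 2 * α * β * C ^ 3 - 1 / 16 * β ^ 2 * B ^ 2 * C
    - 1 / 8 * β ^ 2 * B * C ^ 2) * r

theorem kummer_double (h : IsHalving α β σ A B C) (hμ : σ - α * β ≠ 0) {a t n : ℚ}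
    (ht : β ^ 2 - α ^ 2 = (σ - α * β) * t) (hn : σ + α * β = (σ - α * β) * n)
    (ha : 2 * a = -(α * C - β * B + β * A - α * B) - (β * A - α * B + β * B - α * C) * t
      - (α * A + β * C) * (t ^ 2 - n)) :
    -1 / 8 * α ^ 4 * A ^ 2 + 1 / 2 * α ^ 4 * A * B - 1 / 4 * α ^ 4 * A * C
      - 1 / 8 * α ^ 4 * B ^ 2 - 1 / 8 * α ^ 4 * C ^ 2 - α ^ 3 * β * A ^ 2
      - 1 / 2 * α ^ 3 * β * A * B + α ^ 3 * β * A * C + 1 / 2 * α ^ 3 * β * B ^ 2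
      + 1 / 2 * α ^ 3 * β * B * C + α ^ 3 * β * C ^ 2 + 9 / 4 * α ^ 2 * β ^ 2 * A ^ 2
      - 3 / 2 * α ^ 2 * β ^ 2 * A * B - 3 / 2 * α ^ 2 * β ^ 2 * A * C
      - 3 / 4 * α ^ 2 * β ^ 2 * B ^ 2 - 5 / 2 * α ^ 2 * β ^ 2 * B * C
      - 7 / 4 * α ^ 2 * β ^ 2 * C ^ 2 - 3 / 2 * α ^ 2 * σ * A * B + 1 / 2 * α ^ 2 * σ * B ^ 2
      + 1 / 2 * α ^ 2 * σ * B * C + 1 / 2 * α * β ^ 3 * A * B + α * β ^ 3 * A * C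
      + 1 / 2 * α * β ^ 3 * B ^ 2 + 7 / 2 * α * β ^ 3 * B * C + 2 * α * β * σ * A ^ 2
      + 2 * α * β * σ * A * B - α * β * σ * B ^ 2 - 2 * α * β * σ * B * C - 1 / 8 * β ^ 4 * A ^ 2
      - 1 / 4 * β ^ 4 * A * C - 1 / 8 * β ^ 4 * B ^ 2 - 1 / 2 * β ^ 4 * B * C
      - 1 / 8 * β ^ 4 * C ^ 2 - 1 / 2 * β ^ 2 * σ * A * B + 1 / 2 * β ^ 2 * σ * B ^ 2
      + 3 / 2 * β ^ 2 * σ * B * C + σ ^ 2 * A * B - σ ^ 2 * B * C =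
      (σ - α * β) * kummer t n a := by
  obtain ⟨e₀, e₁, e₂⟩ := h
  have h₂ : 2 * a * (σ - α * β) ^ 2 = -(α * C - β * B + β * A - α * B) * (σ - α * β) ^ 2
      - (β * A - α * B + β * B - α * C) * ((σ - α * β) * t) * (σ - α * β)
      - (α * A + β * C) * (((σ - α * β) * t) ^ 2 - (σ - α * β) * n * (σ - α * β)) := by
    linear_combination (σ - α * β) ^ 2 * ha
  have hk : (σ - α * β) ^ 4 * kummer t n a = (2 * a * (σ - α * β) ^ 2) ^ 2 / 4
      + ((σ - α * β) * t) ^ 3 * (σ - α * β) - (σ - α * β) * t * ((σ - α * β) * n) * (σ - α * β) ^ 2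
      - 2 * ((σ - α * β) * t) ^ 2 * (σ - α * β) ^ 2 - 2 * (σ - α * β) ^ 4 := by
    unfold kummer
    ring
  rw [h₂, ← ht, ← hn] at hk
  apply mul_left_cancel₀ (pow_ne_zero 3 hμ)
  linear_combination (-1 / 4 * α ^ 8 + 1 / 2 * α ^ 6 * β ^ 2 - 3 / 8 * α ^ 5 * β ^ 3 - 1 / 4 * α ^ 4 * β ^ 4
    + 9 / 8 * α ^ 4 * β ^ 2 * σ + 1 / 2 * α ^ 4 * σ ^ 2 - 3 / 8 * α ^ 3 * β ^ 5
    - 7 / 4 * α ^ 3 * β ^ 3 * σ - 9 / 8 * α ^ 3 * β * σ ^ 2 + 1 / 2 * α ^ 2 * β ^ 6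
    + 9 / 8 * α ^ 2 * β ^ 4 * σ + 7 / 4 * α ^ 2 * β ^ 2 * σ ^ 2 + 3 / 8 * α ^ 2 * σ ^ 3
    - 9 / 8 * α * β ^ 3 * σ ^ 2 - 5 / 4 * α * β * σ ^ 3 - 1 / 4 * β ^ 8 + 1 / 2 * β ^ 4 * σ ^ 2
    + 3 / 8 * β ^ 2 * σ ^ 3) * e₀ + (-1 / 2 * α ^ 7 * β + 1 / 2 * α ^ 6 * σ
    + 3 / 2 * α ^ 5 * β ^ 3 - 2 * α ^ 4 * β ^ 4 - 5 / 2 * α ^ 4 * β ^ 2 * σ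
    - 1 / 2 * α ^ 3 * β ^ 5 + 5 * α ^ 3 * β ^ 3 * σ + 2 * α ^ 3 * β * σ ^ 2
    - 1 / 2 * α ^ 2 * β ^ 4 * σ - 3 * α ^ 2 * β ^ 2 * σ ^ 2 - α ^ 2 * σ ^ 3 + 1 / 2 * α * β ^ 7
    + α * β ^ 3 * σ ^ 2 - α * β * σ ^ 3 - 1 / 2 * β ^ 6 * σ + σ ^ 4) * e₁
    + (-1 / 4 * α ^ 6 * β ^ 2 + 1 / 8 * α ^ 5 * β ^ 3 + 1 / 2 * α ^ 5 * β * σ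
    - 1 / 4 * α ^ 4 * β ^ 4 - 3 / 8 * α ^ 4 * β ^ 2 * σ - 1 / 4 * α ^ 4 * σ ^ 2
    + 1 / 8 * α ^ 3 * β ^ 5 + 5 / 4 * α ^ 3 * β ^ 3 * σ + 3 / 8 * α ^ 3 * β * σ ^ 2
    - 1 / 4 * α ^ 2 * β ^ 6 - 3 / 8 * α ^ 2 * β ^ 4 * σ - 7 / 4 * α ^ 2 * β ^ 2 * σ ^ 2
    - 1 / 8 * α ^ 2 * σ ^ 3 + 1 / 2 * α * β ^ 5 * σ + 3 / 8 * α * β ^ 3 * σ ^ 2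
    + 3 / 4 * α * β * σ ^ 3 - 1 / 4 * β ^ 4 * σ ^ 2 - 1 / 8 * β ^ 2 * σ ^ 3) * e₂ - hk

end IsHalving

theorem Int.exists_sq_eq_or_neg_of_isCoprime {a b c : ℤ} (h : IsCoprime a b)
    (e : a * b = c ^ 2) : (∃ d, a = d ^ 2 ∨ a = -d ^ 2) ∧ ∃ d, b = d ^ 2 ∨ b = -d ^ 2 :=
  ⟨Int.sq_of_isCoprime h e, Int.sq_of_isCoprime h.symm (by rw [mul_comm, e])⟩

theorem Int.isCoprime_add_sub_of_odd {m n : ℤ} (h : IsCoprime m n) (hodd : Odd (m + n)) :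
    IsCoprime (m + n) (m - n) := by
  have h2 : IsCoprime (m + n) 2 := by
    obtain ⟨k, hk⟩ := hodd
    exact ⟨1, -k, by rw [hk]; ring⟩
  have hm : IsCoprime (m + n) (2 * m) := h2.mul_right (by
    simpa [add_comm] using h.symm.add_mul_left_left 1)
  have := hm.add_mul_left_right (-1)
  rwa [show 2 * m + (m + n) * -1 = m - n by ring] at this

theorem Int.odd_of_isCoprime_of_even {x y : ℤ} (h : IsCoprime x y) (hy : Even y) : Odd x := by
  rw [← Int.not_even_iff_odd]
  intro hx
  have := h.isUnit_of_dvd' hx.two_dvd hy.two_dvd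
  rw [Int.isUnit_iff] at this
  omega

/-- Fermat: one is not a congruent number. -/
theorem Int.eq_zero_of_sq_add_sq_of_sq_sub_sq (x y z w : ℤ) (h : IsCoprime x y)
    (hz : x ^ 2 + y ^ 2 = z ^ 2) (hw : x ^ 2 - y ^ 2 = w ^ 2) : y = 0 := by
  induction hN : x.natAbs using Nat.strong_induction_on generalizing x y z w with
  | _ N ih =>
  by_contra hy
  have hye : Even y := by
    have key : ∀ a b c d : ZMod 4, a ^ 2 + b ^ 2 = c ^ 2 → a ^ 2 - b ^ 2 = d ^ 2 →
      b ^ 2 = 0 := by decide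
    have := key x y z w (by exact_mod_cast congrArg (Int.cast : ℤ → ZMod 4) hz)
      (by exact_mod_cast congrArg (Int.cast : ℤ → ZMod 4) hw)
    have h4 : (4 : ℤ) ∣ y ^ 2 := by
      rw [← Int.cast_pow] at this
      exact_mod_cast (ZMod.intCast_zmod_eq_zero_iff_dvd (y ^ 2) 4).1 this
    have : Even (y ^ 2) := even_iff_two_dvd.2 ((by norm_num : (2 : ℤ) ∣ 4).trans h4)
    exact (Int.even_pow.1 this).1
  have hxo := Int.odd_of_isCoprime_of_even h hye
  have hzo : Odd z := by
    have : Odd (z ^ 2) := hz ▸ hxo.pow.add_even (hye.pow_of_ne_zero two_ne_zero)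
    exact Int.Odd.of_mul_left (by rwa [pow_two] at this)
  have hwo : Odd w := by
    have : Odd (w ^ 2) := hw ▸ hxo.pow.sub_even (hye.pow_of_ne_zero two_ne_zero)
    exact Int.Odd.of_mul_left (by rwa [pow_two] at this)
  obtain ⟨e, he⟩ := hzo.add_odd hwo
  obtain ⟨f, hf⟩ := hzo.sub_odd hwo
  have hx2 : e ^ 2 + f ^ 2 = x ^ 2 := by
    have : z = e + f := by omega
    have : w = e - f := by omega
    subst z w
    nlinarith
  have hy2 : 2 * (e * f) = y ^ 2 := by
    have : z = e + f := by omega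
    have : w = e - f := by omega
    subst z w
    nlinarith
  have hef : IsCoprime e f := by
    have h2 : IsCoprime (x ^ 2) (y ^ 2) := h.pow
    rw [← hx2, ← hy2] at h2
    obtain ⟨a, b, hab⟩ := h2
    exact ⟨a * e + 2 * b * f, a * f, by linear_combination hab⟩
  obtain ⟨m, n, hmn, hx', hg, hpar⟩ := PythagoreanTriple.coprime_classification.1
    ⟨show PythagoreanTriple e f x by unfold PythagoreanTriple; linarith [hx2],
      Int.isCoprime_iff_gcd_eq_one.1 hef⟩
  have hg' : IsCoprime m n := Int.isCoprime_iff_gcd_eq_one.2 hg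
  obtain ⟨k, hk⟩ := hye
  have hk2 : (m * n) * ((m + n) * (m - n)) = k ^ 2 := by
    subst hk
    rcases hmn with ⟨rfl, rfl⟩ | ⟨rfl, rfl⟩ <;> linarith
  have hodd : Odd (m + n) := by rw [Int.odd_iff]; omega
  have c₁ : IsCoprime m (m + n) := by simpa [add_comm] using (hg'.add_mul_left_right 1)
  have c₂ : IsCoprime m (m - n) := by
    have := hg'.neg_right.add_mul_left_right 1
    rwa [show -n + m * 1 = m - n by ring] at this
  have c₃ : IsCoprime n (m + n) := by simpa [add_comm] using (hg'.symm.add_mul_left_right 1)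
  have c₄ : IsCoprime n (m - n) := by
    have := hg'.symm.add_mul_left_right (-1)
    rwa [show m + n * -1 = m - n by ring] at this
  obtain ⟨⟨p, hp⟩, ⟨q, hq⟩⟩ := Int.exists_sq_eq_or_neg_of_isCoprime
    ((c₁.mul_right c₂).mul_left (c₃.mul_right c₄)) hk2
  have hk0 : k ≠ 0 := by rintro rfl; simp at hk; exact hy hk
  have sq : ∀ {s t r : ℤ}, IsCoprime s t → (s * t = r ^ 2 ∨ s * t = -r ^ 2) →
      (∃ d, s = d ^ 2 ∨ s = -d ^ 2) ∧ ∃ d, t = d ^ 2 ∨ t = -d ^ 2 := by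
    rintro s t r hst (h | h)
    · exact Int.exists_sq_eq_or_neg_of_isCoprime hst h
    · obtain ⟨⟨d, hd⟩, h'⟩ := Int.exists_sq_eq_or_neg_of_isCoprime (a := -s) (b := t) (c := r)
        hst.neg_left (by linarith)
      exact ⟨⟨d, by rcases hd with hd | hd; right; linarith; left; linarith⟩, h'⟩
  obtain ⟨⟨a, ha⟩, ⟨b, hb⟩⟩ := sq hg' hp
  obtain ⟨⟨c, hc⟩, ⟨d, hd⟩⟩ := sq (Int.isCoprime_add_sub_of_odd hg' hodd) hq
  have hm0 : m ≠ 0 := by rintro rfl; apply hk0; simpa using hk2.symm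
  have hn0 : n ≠ 0 := by rintro rfl; apply hk0; simpa using hk2.symm
  have ha0 : a ≠ 0 := by rintro rfl; apply hm0; simpa using ha
  have hb0 : b ≠ 0 := by rintro rfl; apply hn0; simpa using hb
  have hab : IsCoprime a b := by
    have : IsCoprime (a ^ 2) (b ^ 2) := by
      rcases ha with rfl | rfl <;> rcases hb with rfl | rfl <;>
        simpa only [IsCoprime.neg_left_iff, IsCoprime.neg_right_iff] using hg'
    exact (IsCoprime.pow_iff two_pos two_pos).1 this
  have ha2 : 0 < a ^ 2 := by positivity
  have hb2 : 0 < b ^ 2 := by positivity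
  obtain ⟨z', w', hz', hw'⟩ : ∃ z' w' : ℤ, a ^ 2 + b ^ 2 = z' ^ 2 ∧
      (a ^ 2 - b ^ 2 = w' ^ 2 ∨ b ^ 2 - a ^ 2 = w' ^ 2) := by
    have hc2 := sq_nonneg c
    have hd2 := sq_nonneg d
    rcases ha with ha | ha <;> rcases hb with hb | hb <;> rcases hc with hc | hc <;>
      rcases hd with hd | hd <;>
      first
      | exact ⟨c, d, by linarith, Or.inl (by linarith)⟩
      | exact ⟨c, d, by linarith, Or.inr (by linarith)⟩
      | exact ⟨d, c, by linarith, Or.inl (by linarith)⟩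
      | exact ⟨d, c, by linarith, Or.inr (by linarith)⟩
  have hN' : (N : ℤ) = a ^ 4 + b ^ 4 := by
    have h₁ : m ^ 2 = a ^ 4 := by rcases ha with rfl | rfl <;> ring
    have h₂ : n ^ 2 = b ^ 4 := by rcases hb with rfl | rfl <;> ring
    rw [← h₁, ← h₂, ← hN]
    have : 0 ≤ m ^ 2 + n ^ 2 := by positivity
    rcases hx' with hx' | hx' <;> simp only [hx', Int.natCast_natAbs, abs_neg, abs_of_nonneg this]
  have h₁ := Int.natAbs_le_self_sq a
  have h₂ := Int.natAbs_le_self_sq b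
  have h₃ : a ^ 2 ≤ a ^ 4 := by nlinarith
  have h₄ : b ^ 2 ≤ b ^ 4 := by nlinarith
  rcases hw' with hw' | hw'
  · exact hb0 (ih a.natAbs (by rw [← Nat.cast_lt (α := ℤ)]; linarith [pow_pos ha2 2, pow_pos hb2 2]) a b z' w' hab hz' hw' rfl)
  · exact ha0 (ih b.natAbs (by rw [← Nat.cast_lt (α := ℤ)]; linarith [pow_pos ha2 2, pow_pos hb2 2]) b a z' w' hab.symm (by linarith) hw' rfl)

theorem Int.isCoprime_sq_add_sq_of_odd {x y : ℤ} (h : IsCoprime x y) (hodd : Odd (x + y)) :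
    IsCoprime (x ^ 2 + y ^ 2) (x ^ 2 - 2 * x * y - y ^ 2) := by
  have h2 : ∀ {a : ℤ}, Odd a → IsCoprime a 2 := by
    rintro a ⟨k, rfl⟩
    exact ⟨1, -k, by ring⟩
  have hS : Odd (x ^ 2 + y ^ 2) := by
    rw [show x ^ 2 + y ^ 2 = (x + y) ^ 2 - 2 * (x * y) by ring]
    exact hodd.pow.sub_even (even_two_mul _)
  have hd : Odd (x - y) := by
    rw [show x - y = x + y - 2 * y by ring]
    exact hodd.sub_even (even_two_mul _)
  have c₁ : IsCoprime (x ^ 2 + y ^ 2) x := by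
    have := (h.symm.pow_left (m := 2)).add_mul_left_left x
    rwa [show y ^ 2 + x * x = x ^ 2 + y ^ 2 by ring] at this
  have c₂ : IsCoprime (x ^ 2 + y ^ 2) (x - y) := by
    have hy : IsCoprime (x - y) y := by
      have := h.add_mul_left_left (-1)
      rwa [show x + y * -1 = x - y by ring] at this
    have := (((h2 hd).mul_right (hy.pow_right (n := 2))).symm.add_mul_left_left (x + y))
    rwa [show 2 * y ^ 2 + (x - y) * (x + y) = x ^ 2 + y ^ 2 by ring] at this
  have := (((h2 hS).mul_right c₁).mul_right c₂).add_mul_left_right (-1)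
  rwa [show 2 * x * (x - y) + (x ^ 2 + y ^ 2) * -1 = x ^ 2 - 2 * x * y - y ^ 2 by ring] at this

/-- The rational points of the hyperelliptic curve have `u ∈ {0, 1, -1}`. -/
theorem rational_points {u v : ℚ} (h : v ^ 2 = -u * (u ^ 2 + 1) * (u ^ 2 - 2 * u - 1)) :
    u = 0 ∨ u = 1 ∨ u = -1 := by
  obtain ⟨x, y, hy, hxy, hu⟩ : ∃ x y : ℤ, 0 < y ∧ IsCoprime x y ∧ u = x / y :=
    ⟨u.num, u.den, by exact_mod_cast u.den_pos,
      by rw [Int.isCoprime_iff_gcd_eq_one]; exact u.reduced, (Rat.num_div_den u).symm⟩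
  have hyQ : (y : ℚ) ≠ 0 := by exact_mod_cast hy.ne'
  have hsq : IsSquare ((-x * y) * ((x ^ 2 + y ^ 2) * (x ^ 2 - 2 * x * y - y ^ 2))) := by
    rw [← Rat.isSquare_intCast_iff]
    refine ⟨v * y ^ 3, ?_⟩
    have : v * y ^ 3 * (v * y ^ 3) = v ^ 2 * y ^ 6 := by ring
    rw [this, h, hu]
    push_cast
    field_simp
  obtain ⟨w, hw⟩ := hsq
  rw [← pow_two] at hw
  have cop : ∀ {a b : ℤ}, IsCoprime a b → IsCoprime a (a ^ 2 + b ^ 2) ∧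
      IsCoprime b (a ^ 2 - 2 * a * b - b ^ 2) ∧ IsCoprime a (a ^ 2 - 2 * a * b - b ^ 2) := by
    intro a b hab
    refine ⟨?_, ?_, ?_⟩
    · have := (hab.pow_right (n := 2)).add_mul_left_right a
      rwa [show b ^ 2 + a * a = a ^ 2 + b ^ 2 by ring] at this
    · have := (hab.symm.pow_right (n := 2)).add_mul_left_right (-2 * a - b)
      rwa [show a ^ 2 + b * (-2 * a - b) = a ^ 2 - 2 * a * b - b ^ 2 by ring] at this
    · have := (hab.neg_right.pow_right (n := 2)).neg_right.add_mul_left_right (a - 2 * b)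
      rwa [show -(-b) ^ 2 + a * (a - 2 * b) = a ^ 2 - 2 * a * b - b ^ 2 by ring] at this
  have cop' : IsCoprime y (x ^ 2 + y ^ 2) := by
    rw [add_comm]
    exact (cop hxy.symm).1
  obtain ⟨⟨p, hp⟩, ⟨q, hq⟩⟩ := Int.exists_sq_eq_or_neg_of_isCoprime
    ((((cop hxy).1.neg_left.mul_right (cop hxy).2.2.neg_left)).mul_left
      (cop'.mul_right (cop hxy).2.1)) hw
  obtain ⟨⟨a, ha⟩, ⟨b, hb⟩⟩ : (∃ d, x = d ^ 2 ∨ x = -d ^ 2) ∧ ∃ d, y = d ^ 2 ∨ y = -d ^ 2 := by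
    rcases hp with hp | hp
    · obtain ⟨⟨d, hd⟩, h'⟩ := Int.exists_sq_eq_or_neg_of_isCoprime hxy.neg_left hp
      exact ⟨⟨d, by rcases hd with hd | hd; right; linarith; left; linarith⟩, h'⟩
    · exact Int.exists_sq_eq_or_neg_of_isCoprime hxy (by linarith)
  replace hb : y = b ^ 2 := by
    rcases hb with hb | hb
    · exact hb
    · nlinarith [sq_nonneg b]
  have hb0 : b ≠ 0 := by rintro rfl; simp at hb; omega
  have sq : ∀ {s t r : ℤ}, 0 < s → IsCoprime s t → (s * t = r ^ 2 ∨ s * t = -r ^ 2) →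
      ∃ d, s = d ^ 2 := by
    rintro s t r hs hst (h | h)
    · obtain ⟨d, hd | hd⟩ := Int.sq_of_isCoprime hst h
      · exact ⟨d, hd⟩
      · nlinarith [sq_nonneg d]
    · obtain ⟨d, hd | hd⟩ := Int.sq_of_isCoprime (a := s) (b := -t) (c := r)
        hst.neg_right (by linarith)
      · exact ⟨d, hd⟩
      · nlinarith [sq_nonneg d]
  rcases Int.even_or_odd (x + y) with hpar | hpar
  · obtain ⟨e, he⟩ := hpar
    obtain ⟨f, hf⟩ : ∃ f, x - y = f + f := ⟨e - y, by linarith⟩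
    obtain rfl : x = e + f := by linarith
    obtain rfl : y = e - f := by linarith
    have hef : IsCoprime f (-e) := by
      obtain ⟨k, l, hkl⟩ := hxy
      exact ⟨k - l, -(k + l), by linear_combination hkl⟩
    have hodd : Odd (f + -e) := by
      rw [← Int.not_even_iff_odd]
      intro hev
      have h₁ : Even (e - f) := by
        rw [show e - f = -(f + -e) by ring]
        exact hev.neg
      have h₂ : Even (e + f) := by
        rw [show e + f = e - f + 2 * f by ring]
        exact h₁.add (even_two_mul f)
      exact Int.not_even_iff_odd.2 (Int.odd_of_isCoprime_of_even hxy h₁) h₂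
    obtain ⟨q', rfl⟩ : Even q := by
      have : Even (q ^ 2) := by
        rcases hq with hq | hq
        · rw [← hq]; exact ⟨(e ^ 2 + f ^ 2) * ((e + f) ^ 2 - 2 * (e + f) * (e - f) - (e - f) ^ 2),
            by ring⟩
        · rw [← even_neg, ← hq]
          exact ⟨(e ^ 2 + f ^ 2) * ((e + f) ^ 2 - 2 * (e + f) * (e - f) - (e - f) ^ 2), by ring⟩
      exact (Int.even_pow.1 this).1
    have hpos : 0 < f ^ 2 + (-e) ^ 2 := by nlinarith [sq_nonneg (e + f)]
    obtain ⟨r, hr⟩ := sq (r := q') hpos (Int.isCoprime_sq_add_sq_of_odd hef hodd) (by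
      rcases hq with hq | hq
      · left; linarith
      · right; linarith)
    rcases ha with ha | ha
    · have := Int.eq_zero_of_sq_add_sq_of_sq_sub_sq e f r (a * b)
        (by simpa only [IsCoprime.neg_left_iff] using hef.symm) (by linarith)
        (by rw [mul_pow, ← ha, ← hb]; ring)
      right; left
      rw [this] at hyQ hu
      rw [hu]
      push_cast at hyQ ⊢
      rw [add_zero, sub_zero] at *
      field_simp
    · have := Int.eq_zero_of_sq_add_sq_of_sq_sub_sq f (-e) r (a * b) hef (by linarith)
        (by rw [mul_pow, ← hb]; linear_combination (-(e - f)) * ha)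
      right; right
      rw [hu]
      have : e = 0 := by simpa using this
      rw [this] at hyQ ⊢
      push_cast at hyQ ⊢
      field_simp
      ring
  · have hpos : 0 < x ^ 2 + y ^ 2 := by positivity
    obtain ⟨r, hr⟩ := sq hpos (Int.isCoprime_sq_add_sq_of_odd hxy hpar) hq
    by_cases ha0 : a = 0
    · left; subst ha0; simp at ha; simp [hu, ha]
    · refine absurd ?_ (not_fermat_42 (c := r) ha0 hb0)
      rw [← hr, hb]
      rcases ha with rfl | rfl <;> ring

open IsDedekindDomain NumberField in
/-- A multiplicative property of the norm of `x` that can be checked prime by prime. -/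
theorem abs_norm_mem_of_valuation {K : Type*} [Field K] [NumberField K] {H : Submonoid ℚ}
    (hH : ∀ q : ℚ, q * q ∈ H) {x : K} (hx : x ≠ 0)
    (h : ∀ P : HeightOneSpectrum (𝓞 K), IsSquare (P.valuation K x) ∨
      ∀ k : ℤ, (Ideal.absNorm P.asIdeal : ℚ) ^ k ∈ H) : |Algebra.norm ℚ x| ∈ H := by
  classical
  obtain ⟨n, d, rfl⟩ := IsLocalization.exists_mk'_eq (nonZeroDivisors (𝓞 K)) x
  have hn : n ≠ 0 := by
    rintro rfl
    exact hx (IsLocalization.mk'_zero d)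
  have hd : (d : 𝓞 K) ≠ 0 := nonZeroDivisors.ne_zero d.2
  rw [← FractionalIdeal.absNorm_span_singleton (𝓞 K),
    ← FractionalIdeal.finprod_heightOneSpectrum_factorization_principal_fraction hn d]
  refine finprod_induction (fun I => FractionalIdeal.absNorm I ∈ H) (by simp [H.one_mem])
    (fun I J hI hJ => by simpa using H.mul_mem hI hJ) fun P => ?_
  rw [map_zpow₀, FractionalIdeal.coeIdeal_absNorm]
  rcases h P with hP | hP
  · rw [HeightOneSpectrum.valuation_of_mk', HeightOneSpectrum.intValuation_if_neg _ hn,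
      HeightOneSpectrum.intValuation_if_neg _ hd, ← WithZero.exp_sub] at hP
    obtain ⟨g, hg⟩ := hP
    have hg0 : g ≠ 0 := by
      rintro rfl
      simp at hg
    rw [← WithZero.exp_log hg0, ← WithZero.exp_add, WithZero.exp_inj] at hg
    have : ((Associates.mk P.asIdeal).count (Associates.mk (Ideal.span {n})).factors -
        (Associates.mk P.asIdeal).count (Associates.mk (Ideal.span {(d : 𝓞 K)})).factors : ℤ) =
        -WithZero.log g + -WithZero.log g := by linarith
    rw [this]
    by_cases h0 : (Ideal.absNorm P.asIdeal : ℚ) = 0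
    · rcases eq_or_ne (WithZero.log g) 0 with h | h
      · simp [h, H.one_mem]
      · rw [h0, zero_zpow _ (by omega)]
        simpa using hH 0
    · rw [zpow_add₀ h0]
      exact hH _
  · exact hP _

/-- The rationals that are a square or twice a square. -/
def squaresAndDoubles : Submonoid ℚ where
  carrier := {q | IsSquare q ∨ IsSquare (2 * q)}
  one_mem' := Or.inl IsSquare.one
  mul_mem' := by
    rintro a b (⟨r, hr⟩ | ⟨r, hr⟩) (⟨s, hs⟩ | ⟨s, hs⟩)
    · exact Or.inl ⟨r * s, by rw [hr, hs]; ring⟩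
    · exact Or.inr ⟨r * s, by linear_combination a * hs + s * s * hr⟩
    · exact Or.inr ⟨r * s, by linear_combination b * hr + r * r * hs⟩
    · exact Or.inl ⟨r * s / 2, by linear_combination b / 2 * hr + r * r / 4 * hs⟩

section Valuation

variable {K Γ : Type*} [Field K] [LinearOrderedCommGroupWithZero Γ] (w : Valuation K Γ)

theorem Valuation.map_one_add_mul_of_lt {x y : K} (hx : w x < 1) (hy : w y ≤ 1) :
    w (1 + x * y) = 1 :=
  w.map_one_add_of_lt (by
    rw [map_mul]
    exact mul_lt_one_of_lt_of_le hx hy)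

theorem Valuation.map_two_le_one : w 2 ≤ 1 := by
  rw [← one_add_one_eq_two]
  exact w.map_add_le (by simp) (by simp)

theorem Valuation.map_curve_of_lt {u v : K} (hu : w u < 1)
    (h : v ^ 2 = -u * (u ^ 2 + 1) * (u ^ 2 - 2 * u - 1)) : w u = w v ^ 2 := by
  have h₁ : w (1 + u * u) = 1 := w.map_one_add_mul_of_lt hu hu.le
  have h₂ : w (1 + u * (2 - u)) = 1 :=
    w.map_one_add_mul_of_lt hu (w.map_sub_le w.map_two_le_one hu.le)
  rw [← map_pow, h, show -u * (u ^ 2 + 1) * (u ^ 2 - 2 * u - 1) =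
    u * (1 + u * u) * (1 + u * (2 - u)) by ring, map_mul, map_mul, h₁, h₂, mul_one, mul_one]

theorem Valuation.map_curve_of_one_lt {u v : K} (hu : 1 < w u)
    (h : v ^ 2 = -u * (u ^ 2 + 1) * (u ^ 2 - 2 * u - 1)) : w u * w v ^ 2 = w u ^ 6 := by
  have hu0 : u ≠ 0 := by
    rintro rfl
    simp at hu
  have hi : w u⁻¹ < 1 := by
    rw [map_inv₀]
    exact inv_lt_one_of_one_lt₀ hu
  have h₁ : w (1 + u⁻¹ * u⁻¹) = 1 := w.map_one_add_mul_of_lt hi hi.le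
  have h₂ : w (1 + u⁻¹ * (-2 - u⁻¹)) = 1 :=
    w.map_one_add_mul_of_lt hi (w.map_sub_le (by simpa using w.map_two_le_one) hi.le)
  rw [← map_pow w v, h, show -u * (u ^ 2 + 1) * (u ^ 2 - 2 * u - 1) =
    -(u ^ 5) * (1 + u⁻¹ * u⁻¹) * (1 + u⁻¹ * (-2 - u⁻¹)) by field_simp; ring, map_mul, map_mul, h₁,
    h₂, mul_one, mul_one, Valuation.map_neg, map_pow]
  exact (pow_succ' _ 5).symm

theorem Valuation.isSquare_of_curve {u v : K}
    (h : v ^ 2 = -u * (u ^ 2 + 1) * (u ^ 2 - 2 * u - 1)) : IsSquare (w u) := by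
  rcases lt_trichotomy (w u) 1 with hu | hu | hu
  · exact ⟨w v, by rw [w.map_curve_of_lt hu h, pow_two]⟩
  · exact ⟨1, by rw [hu, one_mul]⟩
  · have := w.map_curve_of_one_lt hu h
    have hu0 : w u ≠ 0 := (zero_lt_one.trans hu).ne'
    have hv : w v ≠ 0 := by
      intro hv
      rw [hv, zero_pow two_ne_zero, mul_zero] at this
      exact pow_ne_zero 6 hu0 this.symm
    refine ⟨w u ^ 3 / w v, ?_⟩
    field_simp
    exact mul_left_cancel₀ hu0 (this.trans (pow_succ' _ 5))

theorem Valuation.isSquare_sq_add_one_of_curve {u v : K} (h2 : w 2 = 1)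
    (h : v ^ 2 = -u * (u ^ 2 + 1) * (u ^ 2 - 2 * u - 1)) : IsSquare (w (u ^ 2 + 1)) := by
  rcases lt_trichotomy (w u) 1 with hu | hu | hu
  · exact ⟨1, by
      rw [show u ^ 2 + 1 = 1 + u * u by ring, w.map_one_add_mul_of_lt hu hu.le, one_mul]⟩
  · have hle : w (u ^ 2 + 1) ≤ 1 := w.map_add_le (by rw [map_pow, hu, one_pow]) (by simp)
    rcases hle.lt_or_eq with hlt | heq
    · have h₁ : w (u + 1) = 1 := by
        have : w ((u + 1) ^ 2) = 1 := by
          rw [show (u + 1) ^ 2 = (u ^ 2 + 1) + 2 * u by ring,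
            w.map_add_eq_of_lt_right (by rw [map_mul, h2, hu, one_mul]; exact hlt), map_mul, h2,
            hu, one_mul]
        rw [map_pow] at this
        exact (pow_eq_one_iff.1 this).resolve_right two_ne_zero
      have h₂ : w (u ^ 2 - 2 * u - 1) = 1 := by
        rw [show u ^ 2 - 2 * u - 1 = (u ^ 2 + 1) - 2 * (u + 1) by ring,
          w.map_sub_eq_of_lt_right (by rw [map_mul, h2, h₁, one_mul]; exact hlt), map_mul, h2,
          h₁, one_mul]
      refine ⟨w v, ?_⟩
      rw [← pow_two, ← map_pow, h, map_mul, map_mul, Valuation.map_neg, hu, h₂, one_mul, mul_one]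
    · exact ⟨1, by rw [heq, one_mul]⟩
  · refine ⟨w u, ?_⟩
    rw [w.map_add_eq_of_lt_left (by rw [map_one, map_pow]; exact one_lt_pow₀ hu two_ne_zero),
      map_pow, pow_two]

end Valuation

theorem eq_zero_of_mul_add_eq_zero {K : Type*} [Field K] [CharZero K] {u : K}
    (hu : ∀ q : ℚ, (q : K) ≠ u) {p q : ℚ} (h : (p * u + q : K) = 0) : p = 0 ∧ q = 0 := by
  have hp : p = 0 := by
    by_contra hp
    have hp' : (p : K) ≠ 0 := by exact_mod_cast hp
    apply hu (-q / p)
    push_cast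
    field_simp
    linear_combination -h
  subst hp
  simpa using h

theorem linearIndependent_one_of_irrational {K : Type*} [Field K] [CharZero K] {u : K}
    (hu : ∀ q : ℚ, (q : K) ≠ u) : LinearIndependent ℚ ![(1 : K), u] := by
  rw [LinearIndependent.pair_iff]
  intro a b hab
  simp only [Algebra.smul_def, eq_ratCast, mul_one] at hab
  exact (eq_zero_of_mul_add_eq_zero hu ((add_comm _ _).trans hab)).symm

section Norm

open IsDedekindDomain NumberField

variable {K : Type*} [Field K] [NumberField K] {u v : K}

theorem isSquare_abs_norm_of_curve (hv : v ≠ 0)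
    (h : v ^ 2 = -u * (u ^ 2 + 1) * (u ^ 2 - 2 * u - 1)) : IsSquare |Algebra.norm ℚ u| := by
  have hu : u ≠ 0 := by
    rintro rfl
    simp at h
    exact hv h
  exact abs_norm_mem_of_valuation (H := Submonoid.square ℚ) (fun q => ⟨q, rfl⟩) hu
    fun P => Or.inl ((P.valuation K).isSquare_of_curve h)

theorem norm_sq_add_one_mem_of_curve (hv : v ≠ 0)
    (h : v ^ 2 = -u * (u ^ 2 + 1) * (u ^ 2 - 2 * u - 1)) :
    |Algebra.norm ℚ (u ^ 2 + 1)| ∈ squaresAndDoubles := by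
  have hu : u ^ 2 + 1 ≠ 0 := by
    intro hu
    rw [hu] at h
    simp at h
    exact hv h
  refine abs_norm_mem_of_valuation (fun q => Or.inl ⟨q, rfl⟩) hu fun P => ?_
  by_cases h2 : (2 : 𝓞 K) ∈ P.asIdeal
  · right
    intro k
    have : Ideal.absNorm P.asIdeal ∣ 2 ^ Module.finrank ℤ (𝓞 K) := by
      rw [← Ideal.absNorm_span_natCast]
      apply Ideal.absNorm_dvd_absNorm_of_le
      rw [Ideal.span_singleton_le_iff_mem]
      exact_mod_cast h2
    obtain ⟨j, -, hj⟩ := (Nat.dvd_prime_pow Nat.prime_two).1 this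
    rw [hj]
    push_cast
    rw [← zpow_natCast, ← zpow_mul]
    rcases Int.even_or_odd (j * k) with ⟨i, hi⟩ | ⟨i, hi⟩
    · left
      rw [hi, zpow_add₀ two_ne_zero]
      exact ⟨_, rfl⟩
    · right
      refine ⟨2 ^ (i + 1), ?_⟩
      rw [hi, ← zpow_add₀ two_ne_zero, ← zpow_one_add₀ two_ne_zero]
      congr 1
      ring
  · left
    refine (P.valuation K).isSquare_sq_add_one_of_curve ?_ h
    have := (P.valuation_eq_one_iff_notMem (K := K)).2 h2
    rwa [map_ofNat] at this

/-- The norm form of a quadratic field. -/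
theorem norm_quadratic (hdeg : Module.finrank ℚ K = 2) {t n : ℚ} (hu : ∀ x : ℚ, (x : K) ≠ u)
    (h : u ^ 2 - t * u + n = 0) (p q : ℚ) :
    Algebra.norm ℚ ((p : K) + q * u) = p ^ 2 + p * q * t + q ^ 2 * n := by
  have hli := linearIndependent_one_of_irrational hu
  let B := basisOfLinearIndependentOfCardEqFinrank hli (by simp [hdeg])
  have hB : ⇑B = ![(1 : K), u] := coe_basisOfLinearIndependentOfCardEqFinrank hli _
  have hB0 : B 0 = 1 := by simp [hB]
  have hB1 : B 1 = u := by simp [hB]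
  have e0 : ((p : K) + q * u) * B 0 = p • B 0 + q • B 1 := by
    simp only [hB0, hB1, Algebra.smul_def, eq_ratCast]; ring
  have e1 : ((p : K) + q * u) * B 1 = (-q * n) • B 0 + (p + q * t) • B 1 := by
    simp only [hB0, hB1, Algebra.smul_def, eq_ratCast]
    push_cast
    linear_combination (q : K) * h
  rw [Algebra.norm_eq_matrix_det B, Matrix.det_fin_two]
  simp only [Algebra.leftMulMatrix_eq_repr_mul, e0, e1, map_add, map_smul, Finsupp.add_apply,
    Finsupp.smul_apply, Module.Basis.repr_self, Finsupp.single_apply]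
  simp
  ring

theorem isSquare_of_curve (hdeg : Module.finrank ℚ K = 2) {t n : ℚ} (hu : ∀ x : ℚ, (x : K) ≠ u)
    (hm : u ^ 2 - t * u + n = 0) (hv : v ≠ 0)
    (h : v ^ 2 = -u * (u ^ 2 + 1) * (u ^ 2 - 2 * u - 1)) :
    IsSquare |n| ∧ (n - 1) ^ 2 + t ^ 2 ∈ squaresAndDoubles := by
  have h₁ := isSquare_abs_norm_of_curve hv h
  have h₂ := norm_sq_add_one_mem_of_curve hv h
  have e₁ := norm_quadratic hdeg hu hm 0 1
  have e₂ := norm_quadratic hdeg hu hm (1 - n) t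
  rw [show ((0 : ℚ) : K) + (1 : ℚ) * u = u by simp] at e₁
  rw [show ((1 - n : ℚ) : K) + t * u = u ^ 2 + 1 by push_cast; linear_combination -hm] at e₂
  rw [e₁] at h₁
  rw [e₂, abs_of_nonneg (by nlinarith [sq_nonneg (1 - n), sq_nonneg t])] at h₂
  refine ⟨by simpa using h₁, ?_⟩
  rwa [show (n - 1) ^ 2 + t ^ 2 = (1 - n) ^ 2 + (1 - n) * t * t + t ^ 2 * n by ring]

end Norm

/-- `l • Θ y = x ^ 2` in `R[ζ₈]`, for `x = x₀ + x₁ ζ + x₂ ζ² + x₃ ζ³` and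
`Θ y = y₀ + (y₂ - y₃) ζ + (y₂ - y₁ - y₃) ζ² + (y₂ - y₁) ζ³`. -/
structure IsTwistedSq {R : Type*} [CommRing R] (l x₀ x₁ x₂ x₃ y₀ y₁ y₂ y₃ : R) : Prop where
  e₀ : x₀ ^ 2 - x₂ ^ 2 - 2 * x₁ * x₃ = l * y₀
  e₁ : 2 * x₀ * x₁ - 2 * x₂ * x₃ = l * (y₂ - y₃)
  e₂ : 2 * x₀ * x₂ + x₁ ^ 2 - x₃ ^ 2 = l * (y₂ - y₁ - y₃)
  e₃ : 2 * x₀ * x₃ + 2 * x₁ * x₂ = l * (y₂ - y₁)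

/-- The duplication law on the Kummer surface, up to the factor `l`. -/
def IsDouble (l t n a t' n' a' : ℚ) : Prop :=
  IsTwistedSq l (kummer t' n' a' + 1 + n') 2 (1 - t' - n') (-2 * n')
    (kummer t n a + 1 + n) 2 (1 - t - n) (-2 * n)

theorem IsHalving.curve_of_root {α β σ A B C x : ℚ} (h : IsHalving α β σ A B C)
    (hx : A * x ^ 2 - B * x + C = 0) :
    ((β * x - α) * (C * x ^ 2 + B * x + A) / 2) ^ 2 = -x * (x ^ 2 + 1) * (x ^ 2 - 2 * x - 1) := by
  obtain ⟨e₀, e₁, e₂⟩ := h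
  linear_combination (x ^ 6 + 1) / 4 * e₀ + (x ^ 5 - x) / 2 * e₁ + (x ^ 4 + x ^ 2) / 4 * e₂ -
    ((α * x + β) ^ 2 * (A * x ^ 2 - B * x + C) / 4 +
      σ / 2 * (x ^ 2 + 1) * (C * x ^ 2 + B * x + A)) * hx

theorem exists_half {t a b s q : ℚ} (hD : IsMumford t (s ^ 2) a b)
    (hirr : ∀ x : ℚ, x ^ 2 - t * x + s ^ 2 ≠ 0) (hs : s ≠ 0) (hs' : s ≠ -1) (hq : q < 0)
    (ht : t = (q ^ 2 - (s ^ 2 - 1) ^ 2) / (2 * q)) :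
    ∃ t' n' a' b' ρ : ℚ, IsMumford t' n' a' b' ∧ (∀ x : ℚ, x ^ 2 - t' * x + n' ≠ 0) ∧
      -q * n' = (s + 1) ^ 2 ∧ n' ≠ 1 ∧ ρ ≠ 0 ∧
      IsDouble (-q * ((n' - 1) ^ 2 + t' ^ 2) * ρ ^ 2) t (s ^ 2) a t' n' a' := by
  obtain ⟨h₁, h₂⟩ := hD
  have hq0 : q ≠ 0 := hq.ne
  obtain ⟨A, B, C, e₀, e₁, e₂, ea⟩ := halving_exists s q a b t hs hq0 (by positivity)
    (by nlinarith [sq_nonneg (s + 1)]) ht (by linear_combination h₁) (by linear_combination h₂)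
  have hH : IsHalving (s ^ 2 - 1) q ((s ^ 2 + 1) * q) A B C :=
    ⟨by linear_combination (q * C + (s - 1) ^ 2 * A) * e₀, e₁, e₂⟩
  have hs1 : 0 < (s + 1) ^ 2 := by
    have : s + 1 ≠ 0 := fun h => hs' (by linear_combination h)
    positivity
  have hA : A ≠ 0 := by
    rintro rfl
    have hC : C = 0 := by simpa [hq0] using e₀
    rw [hC] at e₁
    norm_num at e₁
  have hn : -q * (C / A) = (s + 1) ^ 2 := by
    field_simp
    linear_combination -e₀
  have hpos : 0 < C / A := by
    by_contra h
    nlinarith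
  have hne : C / A ≠ 1 := by
    intro h
    rw [h] at hn
    have hq' : q = -(s + 1) ^ 2 := by linear_combination -hn
    have ht' : t = -2 * s := by
      rw [ht, hq']
      have : s + 1 ≠ 0 := fun h => hs' (by linear_combination h)
      field_simp
      ring
    exact hirr (-s) (by rw [ht']; ring)
  have hAC : A + C ≠ 0 := by
    intro h
    have : C / A = -1 := by
      field_simp
      linear_combination h
    linarith
  have hM := hH.isMumford hA
  have hK := hH.kummer_eq hA hAC rfl
  obtain ⟨d₁, d₂, d₃, d₄⟩ := hH.duplication hAC rfl rfl
  have hμ : (s ^ 2 + 1) * q - (s ^ 2 - 1) * q ≠ 0 := by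
    rw [show (s ^ 2 + 1) * q - (s ^ 2 - 1) * q = 2 * q by ring]
    exact mul_ne_zero two_ne_zero hq0
  have hκ := hH.kummer_double hμ (t := t) (n := s ^ 2) (a := a)
    (by rw [ht]; field_simp; ring) (by ring) ea
  rw [hκ] at d₄
  rw [← hK] at d₁ d₂ d₃ d₄
  clear hκ hK
  refine ⟨_, _, _, _, A + C, hM, ?_, hn, hne, hAC, ?_⟩
  · have key : ∀ x : ℚ, x ^ 2 - B / A * x + C / A = 0 → x = 0 ∨ x = 1 ∨ x = -1 := by
      intro x hx
      refine rational_points (hH.curve_of_root (x := x) ?_)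
      field_simp at hx
      linear_combination hx
    intro x hx
    have hx' : (B / A - x) ^ 2 - B / A * (B / A - x) + C / A = 0 := by linear_combination hx
    have hp : C / A = x * (B / A - x) := by linear_combination hx
    rcases key x hx with h | h | h <;> rcases key _ hx' with h' | h' | h' <;>
      rw [h', h] at hp <;> first | linarith | exact hne (by linarith)
  · have hq2 : q ^ 2 - (s ^ 2 - 1) ^ 2 = 2 * q * t := by rw [ht]; field_simp
    rw [hq2] at d₂
    unfold IsDouble
    generalize kummer (B / A) (C / A) _ = k' at *
    generalize kummer t (s ^ 2) a = k at *
    obtain ⟨t', rfl⟩ : ∃ t', B = A * t' := ⟨B / A, by field_simp⟩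
    obtain ⟨n', rfl⟩ : ∃ n', C = A * n' := ⟨C / A, by field_simp⟩
    rw [mul_div_cancel_left₀ _ hA, mul_div_cancel_left₀ _ hA]
    have hA2 : A ^ 2 ≠ 0 := pow_ne_zero 2 hA
    constructor <;> apply mul_left_cancel₀ hA2
    · linear_combination d₄ + d₁ + d₃
    · linear_combination d₁ - d₂ + d₃
    · linear_combination -d₁ - d₂ + d₃
    · linear_combination -d₁ - d₂ - d₃

/-- The function `y = a x + b` has divisor containing both points above the roots of
`x² - t x + n`. -/
theorem IsMumford.curve {R : Type*} [Field R] [CharZero R] {t n a b : ℚ} (h : IsMumford t n a b)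
    {x : R} (hx : x ^ 2 - t * x + n = 0) :
    (a * x + b) ^ 2 = -x * (x ^ 2 + 1) * (x ^ 2 - 2 * x - 1) := by
  obtain ⟨h₁, h₂⟩ := h
  have h₁' : (a ^ 2 * t + 2 * a * b : R) = -t ^ 4 + 3 * t ^ 2 * n - n ^ 2 + 2 * t ^ 3 - 4 * t * n +
    2 * t + 1 := by exact_mod_cast h₁
  have h₂' : (b ^ 2 - a ^ 2 * n : R) = t ^ 3 * n - 2 * t * n ^ 2 - 2 * t ^ 2 * n + 2 * n ^ 2 -
    2 * n := by exact_mod_cast h₂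
  linear_combination x * h₁' + h₂' + (a ^ 2 + x ^ 3 + (t - 2) * x ^ 2 + (t ^ 2 - n - 2 * t) * x +
    (t ^ 3 - 2 * t * n - 2 * t ^ 2 + 2 * n - 2)) * hx

theorem IsMumford.root {t n a b x : ℚ} (h : IsMumford t n a b) (hx : x ^ 2 - t * x + n = 0) :
    x = 0 ∨ x = 1 ∨ x = -1 :=
  rational_points (h.curve (R := ℚ) (by exact_mod_cast hx))

open QuadraticAlgebra in
theorem IsMumford.isSquare {t n a b : ℚ} (h : IsMumford t n a b)
    (hirr : ∀ x : ℚ, x ^ 2 - t * x + n ≠ 0) (hn : n ≠ 1) (hn' : n ≠ -1) :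
    IsSquare |n| ∧ (n - 1) ^ 2 + t ^ 2 ∈ squaresAndDoubles := by
  have : Fact (∀ r : ℚ, r ^ 2 ≠ -n + t * r) := ⟨fun r hr => hirr r (by linear_combination hr)⟩
  let u : QuadraticAlgebra ℚ (-n) t := omega
  have hfin : Module.finrank ℚ (QuadraticAlgebra ℚ (-n) t) = 2 := by
    have := QuadraticAlgebra.finrank_eq_two (R := ℚ) (-n) t
    convert this
  have : NumberField (QuadraticAlgebra ℚ (-n) t) :=
    { to_charZero := inferInstance
      to_finiteDimensional := Module.finite_of_finrank_eq_succ hfin }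
  have hm : u ^ 2 - t * u + n = 0 := by
    ext <;> simp [u, pow_two]
  have hu : ∀ x : ℚ, (x : QuadraticAlgebra ℚ (-n) t) ≠ u := by
    intro x hx
    have := congrArg QuadraticAlgebra.im hx
    simp [u] at this
  have hli : ∀ p q : ℚ, p * u + q = 0 → p = 0 ∧ q = 0 := by
    intro p q hpq
    have h₁ := congrArg QuadraticAlgebra.im hpq
    have h₂ := congrArg QuadraticAlgebra.re hpq
    simp [u] at h₁ h₂
    exact ⟨h₁, h₂⟩
  have hc := h.curve hm
  refine isSquare_of_curve hfin hu hm (v := a * u + b) ?_ hc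
  intro hv
  rw [hv, zero_pow two_ne_zero, eq_comm, mul_eq_zero, mul_eq_zero, neg_eq_zero] at hc
  rcases hc with (hc | hc) | hc
  · exact hu 0 (by rw [hc, Rat.cast_zero])
  · exact hn (by linarith [(hli t (1 - n) (by push_cast; linear_combination hc - hm)).2])
  · exact hn' (by linarith [(hli (t - 2) (-n - 1) (by push_cast; linear_combination hc - hm)).2])

theorem eq_zero_of_sq_eq_two_mul_sq {x y : ℚ} (h : x ^ 2 = 2 * y ^ 2) : x = 0 ∧ y = 0 := by
  have hy : y = 0 := by
    by_contra hy
    have h2 : IsSquare (2 : ℚ) := ⟨x / y, by field_simp; linear_combination -h⟩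
    have : IsSquare ((2 : ℕ) : ℚ) := by exact_mod_cast h2
    rw [Rat.isSquare_natCast_iff] at this
    exact Nat.prime_two.prime.not_isSquare this
  subst hy
  simpa using h

/-- `ℚ[ζ₈]` has no zero divisors. -/
theorem zeta_mul_eq_zero {p₀ p₁ p₂ p₃ r₀ r₁ r₂ r₃ : ℚ}
    (h₀ : p₀ * r₀ - p₁ * r₃ - p₂ * r₂ - p₃ * r₁ = 0)
    (h₁ : p₀ * r₁ + p₁ * r₀ - p₂ * r₃ - p₃ * r₂ = 0)
    (h₂ : p₀ * r₂ + p₁ * r₁ + p₂ * r₀ - p₃ * r₃ = 0)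
    (h₃ : p₀ * r₃ + p₁ * r₂ + p₂ * r₁ + p₃ * r₀ = 0) :
    (p₁ = 0 ∧ p₃ = 0) ∨ (r₁ = 0 ∧ r₃ = 0) := by
  by_cases hp : p₁ = 0 ∧ p₃ = 0
  · exact Or.inl hp
  right
  obtain ⟨x, hx⟩ : ∃ x, x = p₀ ^ 2 - p₂ ^ 2 + 2 * p₁ * p₃ := ⟨_, rfl⟩
  obtain ⟨y, hy⟩ : ∃ y, y = 2 * p₀ * p₂ - p₁ ^ 2 + p₃ ^ 2 := ⟨_, rfl⟩
  have hxy : x ^ 2 + y ^ 2 ≠ 0 := by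
    intro h
    have hx0 : x = 0 := by nlinarith [sq_nonneg x, sq_nonneg y]
    have hy0 : y = 0 := by nlinarith [sq_nonneg x, sq_nonneg y]
    rw [hx0] at hx
    rw [hy0] at hy
    have hsq : (p₀ ^ 2 + p₂ ^ 2) ^ 2 = (p₁ ^ 2 + p₃ ^ 2) ^ 2 := by
      linear_combination (-(p₀ ^ 2 - p₂ ^ 2) + 2 * p₁ * p₃) * hx -
        (2 * p₀ * p₂ + p₁ ^ 2 - p₃ ^ 2) * hy
    have hn : p₀ ^ 2 + p₂ ^ 2 = p₁ ^ 2 + p₃ ^ 2 :=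
      (sq_eq_sq₀ (by positivity) (by positivity)).1 hsq
    have e₁ : (p₀ + p₂) ^ 2 = 2 * p₁ ^ 2 := by linear_combination hn - hy
    have e₂ : (p₀ - p₂) ^ 2 = 2 * p₃ ^ 2 := by linear_combination hn + hy
    exact hp ⟨(eq_zero_of_sq_eq_two_mul_sq e₁).2, (eq_zero_of_sq_eq_two_mul_sq e₂).2⟩
  have f₁ : x * r₁ - y * r₃ = 0 := by
    rw [hx, hy]
    linear_combination p₀ * h₁ - p₁ * h₀ - p₂ * h₃ + p₃ * h₂
  have f₃ : x * r₃ + y * r₁ = 0 := by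
    rw [hx, hy]
    linear_combination p₀ * h₃ - p₁ * h₂ + p₂ * h₁ - p₃ * h₀
  constructor
  · exact (mul_eq_zero.1 (show (x ^ 2 + y ^ 2) * r₁ = 0 by
      linear_combination x * f₁ + y * f₃)).resolve_left hxy
  · exact (mul_eq_zero.1 (show (x ^ 2 + y ^ 2) * r₃ = 0 by
      linear_combination x * f₃ - y * f₁)).resolve_left hxy

/-- The twisted square determines `x₃ / x₁`. -/
theorem IsTwistedSq.unique {l l' m m' x₀ x₂ x₃ x₀' x₂' x₃' y₀ y₁ y₂ y₃ : ℚ}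
    (h : IsTwistedSq l x₀ 2 x₂ x₃ y₀ y₁ y₂ y₃) (h' : IsTwistedSq l' x₀' 2 x₂' x₃' y₀ y₁ y₂ y₃)
    (hl : 2 * l = m ^ 2) (hl' : 2 * l' = m' ^ 2) (hm : m ≠ 0) : x₃ = x₃' := by
  obtain ⟨e₀, e₁, e₂, e₃⟩ := h
  obtain ⟨f₀, f₁, f₂, f₃⟩ := h'
  have key := zeta_mul_eq_zero (p₀ := m' * x₀ - m * x₀') (p₁ := m' * 2 - m * 2)
    (p₂ := m' * x₂ - m * x₂') (p₃ := m' * x₃ - m * x₃') (r₀ := m' * x₀ + m * x₀')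
    (r₁ := m' * 2 + m * 2) (r₂ := m' * x₂ + m * x₂') (r₃ := m' * x₃ + m * x₃')
    (by linear_combination m' ^ 2 * e₀ - m ^ 2 * f₀ + l' * y₀ * hl - l * y₀ * hl')
    (by linear_combination m' ^ 2 * e₁ - m ^ 2 * f₁ + (y₂ - y₃) * (l' * hl - l * hl'))
    (by linear_combination m' ^ 2 * e₂ - m ^ 2 * f₂ + (y₂ - y₁ - y₃) * (l' * hl - l * hl'))
    (by linear_combination m' ^ 2 * e₃ - m ^ 2 * f₃ + (y₂ - y₁) * (l' * hl - l * hl'))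
  apply mul_left_cancel₀ hm
  rcases key with ⟨k₁, k₃⟩ | ⟨k₁, k₃⟩
  · linear_combination k₃ - x₃ / 2 * k₁
  · linear_combination -k₃ + x₃ / 2 * k₁

/-- A divisor all of whose 2-descent invariants vanish. -/
structure IsGood (t n a b : ℚ) : Prop where
  isMumford : IsMumford t n a b
  irreducible : ∀ x : ℚ, x ^ 2 - t * x + n ≠ 0
  ne_one : n ≠ 1
  isSquare : IsSquare n
  isSquare' : IsSquare ((n - 1) ^ 2 + t ^ 2)

theorem IsGood.exists_half_or {t a b s q : ℚ} (h : IsGood t (s ^ 2) a b) (hs' : s ≠ -1)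
    (hq : q < 0) (ht : t = (q ^ 2 - (s ^ 2 - 1) ^ 2) / (2 * q)) :
    ∃ t' n' a' b' l : ℚ, -q * n' = (s + 1) ^ 2 ∧ IsDouble l t (s ^ 2) a t' n' a' ∧
      (IsGood t' n' a' b' ∨ ∃ m : ℚ, m ≠ 0 ∧ 2 * l = m ^ 2) := by
  have hs : s ≠ 0 := by
    rintro rfl
    exact h.irreducible 0 (by ring)
  obtain ⟨t', n', a', b', ρ, hM, hirr, hn, hn1, hρ, hD⟩ :=
    exists_half h.isMumford h.irreducible hs hs' hq ht
  have hs1 : s + 1 ≠ 0 := fun h => hs' (by linear_combination h)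
  have hs2 : 0 < (s + 1) ^ 2 := by positivity
  have hpos : 0 < n' := by
    by_contra h
    nlinarith
  obtain ⟨hsq, hS⟩ := hM.isSquare hirr hn1 (by linarith)
  rw [abs_of_pos hpos] at hsq
  refine ⟨t', n', a', b', _, hn, hD, ?_⟩
  rcases hS with hS | ⟨c, hc⟩
  · exact Or.inl ⟨hM, hirr, hn1, hsq, hS⟩
  · right
    obtain ⟨g, rfl⟩ := hsq
    have hg : g ≠ 0 := by
      rintro rfl
      simp at hpos
    have hq' : -q = ((s + 1) / g) ^ 2 := by
      field_simp
      linear_combination hn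
    have hc0 : c ≠ 0 := by
      rintro rfl
      have : g * g - 1 ≠ 0 := sub_ne_zero.2 hn1
      have : 0 < (g * g - 1) ^ 2 := by positivity
      nlinarith [sq_nonneg t']
    refine ⟨(s + 1) / g * c * ρ, by positivity, ?_⟩
    rw [hq']
    linear_combination ((s + 1) / g) ^ 2 * ρ ^ 2 * hc

/-- Every good divisor is twice a good divisor. -/
theorem IsGood.exists_half {t n a b : ℚ} (h : IsGood t n a b) :
    ∃ t' n' a' b' l : ℚ, IsGood t' n' a' b' ∧ IsDouble l t n a t' n' a' := by
  obtain ⟨s, hs⟩ := h.isSquare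
  obtain rfl : n = s ^ 2 := by rw [hs, pow_two]
  obtain ⟨r, hr⟩ := h.isSquare'
  have h1 : s ^ 2 - 1 ≠ 0 := sub_ne_zero.2 h.ne_one
  have hlt : t < |r| := by
    refine lt_of_le_of_lt (le_abs_self t) (sq_lt_sq.1 ?_)
    have : 0 < (s ^ 2 - 1) ^ 2 := by positivity
    linarith
  have hq : t - |r| < 0 := by linarith
  have ht : t = ((t - |r|) ^ 2 - (s ^ 2 - 1) ^ 2) / (2 * (t - |r|)) := by
    have := hq.ne
    have habs : |r| ^ 2 = r ^ 2 := sq_abs r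
    field_simp
    linear_combination -habs + hr
  have hs1 : s ≠ -1 := by
    rintro rfl
    norm_num at h1
  have hs2 : -s ≠ -1 := by
    intro h
    rw [neg_inj.1 h] at h1
    norm_num at h1
  obtain ⟨t₁, n₁, a₁, b₁, l₁, hn₁, hD₁, h₁⟩ := h.exists_half_or hs1 hq ht
  rw [← neg_sq s] at h ht
  obtain ⟨t₂, n₂, a₂, b₂, l₂, hn₂, hD₂, h₂⟩ := h.exists_half_or hs2 hq ht
  rcases h₁ with h₁ | ⟨m, hm, hl⟩
  · exact ⟨_, _, _, _, _, h₁, hD₁⟩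
  rw [neg_sq] at hD₂ h
  rcases h₂ with h₂ | ⟨m', -, hl'⟩
  · exact ⟨_, _, _, _, _, h₂, hD₂⟩
  have hn : n₁ = n₂ := by linarith [IsTwistedSq.unique hD₁ hD₂ hl hl' hm]
  refine absurd ?_ (h.irreducible 0)
  have : s = 0 := by
    rw [hn] at hn₁
    linear_combination (hn₂ - hn₁) / 4
  rw [this]
  ring

/-- The integers `yᵢ` are proportional to the Kummer coordinates. -/
def Represents (y : Fin 4 → ℤ) (t n a : ℚ) : Prop :=
  ∃ c : ℚ, c ≠ 0 ∧ y 0 = c * (kummer t n a + 1 + n) ∧ y 1 = c * 2 ∧ y 2 = c * (1 - t - n) ∧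
    y 3 = c * (-2 * n)

/-- The integers `yᵢ` have no common factor. -/
def IsPrimitiveVec (y : Fin 4 → ℤ) : Prop := ∀ d : ℤ, (∀ i, d ∣ y i) → IsUnit d

theorem exists_represents (t n a : ℚ) : ∃ y, Represents y t n a ∧ IsPrimitiveVec y := by
  obtain ⟨y, c, hc, hy⟩ : ∃ (y : Fin 4 → ℤ) (c : ℚ), c ≠ 0 ∧
      ((y 0 : ℚ) = c * (kummer t n a + 1 + n) ∧ (y 1 : ℚ) = c * 2 ∧ (y 2 : ℚ) = c * (1 - t - n) ∧
      (y 3 : ℚ) = c * (-2 * n)) := by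
    obtain ⟨p, d, hd, hp⟩ : ∃ (p : ℤ) (d : ℤ), (d : ℚ) ≠ 0 ∧ kummer t n a + 1 + n = p / d :=
      ⟨_, _, by exact_mod_cast (Rat.den_ne_zero _), (Rat.num_div_den _).symm⟩
    obtain ⟨p', d', hd', hp'⟩ : ∃ (p : ℤ) (d : ℤ), (d : ℚ) ≠ 0 ∧ 1 - t - n = p / d :=
      ⟨_, _, by exact_mod_cast (Rat.den_ne_zero _), (Rat.num_div_den _).symm⟩
    obtain ⟨p'', d'', hd'', hp''⟩ : ∃ (p : ℤ) (d : ℤ), (d : ℚ) ≠ 0 ∧ n = p / d :=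
      ⟨_, _, by exact_mod_cast (Rat.den_ne_zero _), (Rat.num_div_den _).symm⟩
    refine ⟨![p * d' * d'', 2 * d * d' * d'', p' * d * d'', -2 * p'' * d * d'], d * d' * d'',
      by positivity, ?_, ?_, ?_, ?_⟩
    · rw [hp]
      simp
      field_simp
    · simp
      ring
    · rw [hp']
      simp
      field_simp
    · rw [hp'']
      simp
      field_simp
  obtain ⟨g, hg, hg'⟩ := Finset.extract_gcd y (Finset.univ_nonempty (α := Fin 4))
  set e := Finset.univ.gcd y with he
  have hy1 : (y 1 : ℚ) ≠ 0 := by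
    rw [hy.2.1]
    positivity
  have he0 : (e : ℚ) ≠ 0 := by
    intro h
    apply hy1
    rw [hg 1 (Finset.mem_univ _)]
    push_cast
    rw [h, zero_mul]
  have hg₀ : ∀ i, (y i : ℚ) = e * g i := fun i => by exact_mod_cast hg i (Finset.mem_univ _)
  refine ⟨g, ⟨c / e, by positivity, ?_, ?_, ?_, ?_⟩, fun d hd => ?_⟩
  · field_simp
    linear_combination hy.1 - hg₀ 0
  · field_simp
    linear_combination hy.2.1 - hg₀ 1
  · field_simp
    linear_combination hy.2.2.1 - hg₀ 2
  · field_simp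
    linear_combination hy.2.2.2 - hg₀ 3
  · exact isUnit_of_dvd_one (hg' ▸ Finset.dvd_gcd fun i _ => hd i)

theorem zeta_sq_eq_zero_aux {F : Type*} [Field F] (h2 : (2 : F) ≠ 0) {x₀ x₁ x₂ x₃ : F}
    (e₀ : x₀ ^ 2 - x₂ ^ 2 - 2 * x₁ * x₃ = 0) (e₁ : 2 * x₀ * x₁ - 2 * x₂ * x₃ = 0)
    (e₂ : 2 * x₀ * x₂ + x₁ ^ 2 - x₃ ^ 2 = 0) (e₃ : 2 * x₀ * x₃ + 2 * x₁ * x₂ = 0) :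
    x₀ = 0 ∧ x₂ = 0 := by
  have f₁ : x₀ * x₁ - x₂ * x₃ = 0 := by
    apply mul_left_cancel₀ h2
    linear_combination e₁
  have f₃ : x₀ * x₃ + x₁ * x₂ = 0 := by
    apply mul_left_cancel₀ h2
    linear_combination e₃
  have hre : x₀ ^ 3 - 3 * x₀ * x₂ ^ 2 = 0 := by
    linear_combination x₀ * e₀ - x₂ * e₂ + x₃ * f₁ + x₁ * f₃
  have him : 3 * x₀ ^ 2 * x₂ - x₂ ^ 3 = 0 := by
    linear_combination x₂ * e₀ + x₀ * e₂ - x₁ * f₁ + x₃ * f₃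
  have hn : x₀ ^ 2 + x₂ ^ 2 = 0 := by
    apply eq_zero_of_pow_eq_zero (n := 3)
    linear_combination (x₀ ^ 3 - 3 * x₀ * x₂ ^ 2) * hre + (3 * x₀ ^ 2 * x₂ - x₂ ^ 3) * him
  have hx : x₀ = 0 := by
    apply eq_zero_of_pow_eq_zero (n := 3)
    apply mul_left_cancel₀ (mul_ne_zero h2 h2)
    linear_combination hre + 3 * x₀ * hn
  refine ⟨hx, eq_zero_of_pow_eq_zero (n := 2) ?_⟩
  linear_combination hn - x₀ * hx

/-- Away from `2`, the ring `ℤ[ζ₈]` is reduced modulo primes. -/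
theorem zeta_sq_eq_zero {F : Type*} [Field F] (h2 : (2 : F) ≠ 0) {x₀ x₁ x₂ x₃ : F}
    (e₀ : x₀ ^ 2 - x₂ ^ 2 - 2 * x₁ * x₃ = 0) (e₁ : 2 * x₀ * x₁ - 2 * x₂ * x₃ = 0)
    (e₂ : 2 * x₀ * x₂ + x₁ ^ 2 - x₃ ^ 2 = 0) (e₃ : 2 * x₀ * x₃ + 2 * x₁ * x₂ = 0) :
    x₀ = 0 ∧ x₁ = 0 ∧ x₂ = 0 ∧ x₃ = 0 := by
  obtain ⟨h₀, h₂⟩ := zeta_sq_eq_zero_aux h2 e₀ e₁ e₂ e₃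
  obtain ⟨h₃, h₁⟩ := zeta_sq_eq_zero_aux h2 (x₀ := -x₃) (x₁ := x₀) (x₂ := x₁) (x₃ := x₂)
    (by linear_combination -e₂) (by linear_combination -e₃) (by linear_combination e₀)
    (by linear_combination e₁)
  exact ⟨h₀, h₁, h₂, neg_eq_zero.1 h₃⟩

theorem zeta_sq_eq_zero_mod_four : ∀ x₀ x₁ x₂ x₃ : ZMod 4,
    x₀ ^ 2 - x₂ ^ 2 - 2 * x₁ * x₃ = 0 → 2 * x₀ * x₁ - 2 * x₂ * x₃ = 0 →
    2 * x₀ * x₂ + x₁ ^ 2 - x₃ ^ 2 = 0 → 2 * x₀ * x₃ + 2 * x₁ * x₂ = 0 →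
    2 * x₀ = 0 ∧ 2 * x₁ = 0 ∧ 2 * x₂ = 0 ∧ 2 * x₃ = 0 := by
  decide +kernel

theorem IsTwistedSq.cast {R : Type*} [CommRing R] {l x₀ x₁ x₂ x₃ y₀ y₁ y₂ y₃ : ℤ}
    (h : IsTwistedSq l x₀ x₁ x₂ x₃ y₀ y₁ y₂ y₃) :
    IsTwistedSq (l : R) x₀ x₁ x₂ x₃ y₀ y₁ y₂ y₃ := by
  obtain ⟨e₀, e₁, e₂, e₃⟩ := h
  constructor
  · exact_mod_cast congrArg (Int.cast (R := R)) e₀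
  · exact_mod_cast congrArg (Int.cast (R := R)) e₁
  · exact_mod_cast congrArg (Int.cast (R := R)) e₂
  · exact_mod_cast congrArg (Int.cast (R := R)) e₃

theorem IsTwistedSq.abs_le_two {l : ℤ} {x y : Fin 4 → ℤ} (hx : IsPrimitiveVec x)
    (h : IsTwistedSq l (x 0) (x 1) (x 2) (x 3) (y 0) (y 1) (y 2) (y 3)) : |l| ≤ 2 := by
  have hodd : ∀ p : ℕ, p.Prime → p ∣ l.natAbs → p = 2 := by
    intro p hp hpl
    by_contra hp2
    have : Fact p.Prime := ⟨hp⟩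
    have hl : (l : ZMod p) = 0 := by
      rw [ZMod.intCast_zmod_eq_zero_iff_dvd]
      exact Int.natCast_dvd.2 hpl
    have h2 : (2 : ZMod p) ≠ 0 := by
      intro h2
      have : ((2 : ℕ) : ZMod p) = 0 := by exact_mod_cast h2
      rw [ZMod.natCast_eq_zero_iff] at this
      exact hp2 ((Nat.prime_dvd_prime_iff_eq hp Nat.prime_two).1 this)
    obtain ⟨e₀, e₁, e₂, e₃⟩ := h.cast (R := ZMod p)
    rw [hl, zero_mul] at e₀ e₁ e₂ e₃
    obtain ⟨h₀, h₁, h₂, h₃⟩ := zeta_sq_eq_zero h2 e₀ e₁ e₂ e₃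
    rw [ZMod.intCast_zmod_eq_zero_iff_dvd] at h₀ h₁ h₂ h₃
    have := hx p (by
      intro i
      fin_cases i <;> assumption)
    rw [Int.isUnit_iff_natAbs_eq] at this
    simp only [Int.natAbs_natCast] at this
    exact hp.one_lt.ne' this
  have h4 : ¬ 4 ∣ l.natAbs := by
    intro h4
    have hl : (l : ZMod 4) = 0 := by
      rw [ZMod.intCast_zmod_eq_zero_iff_dvd]
      exact Int.natCast_dvd.2 h4
    obtain ⟨e₀, e₁, e₂, e₃⟩ := h.cast (R := ZMod 4)
    rw [hl, zero_mul] at e₀ e₁ e₂ e₃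
    obtain ⟨h₀, h₁, h₂, h₃⟩ := zeta_sq_eq_zero_mod_four _ _ _ _ e₀ e₁ e₂ e₃
    have key : ∀ z : ℤ, (2 * z : ZMod 4) = 0 → (2 : ℤ) ∣ z := by
      intro z hz
      have : ((2 * z : ℤ) : ZMod 4) = 0 := by exact_mod_cast hz
      rw [ZMod.intCast_zmod_eq_zero_iff_dvd] at this
      push_cast at this
      omega
    have := hx 2 (by
      intro i
      fin_cases i
      · exact key _ h₀
      · exact key _ h₁
      · exact key _ h₂
      · exact key _ h₃)
    norm_num [Int.isUnit_iff] at this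
  have hl0 : l.natAbs ≠ 0 := fun h => h4 (h ▸ dvd_zero 4)
  have hpow := Nat.eq_prime_pow_of_unique_prime_dvd hl0 (hodd _)
  have hlt : l.natAbs.primeFactorsList.length < 2 := by
    by_contra hge
    exact h4 (hpow ▸ pow_dvd_pow 2 (not_lt.1 hge))
  have hle : l.natAbs ≤ 2 := by
    rw [hpow]
    calc 2 ^ l.natAbs.primeFactorsList.length ≤ 2 ^ 1 :=
          Nat.pow_le_pow_right two_pos (Nat.lt_succ_iff.1 hlt)
      _ = 2 := by norm_num
  rw [Int.abs_eq_natAbs]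
  exact_mod_cast hle

theorem IsTwistedSq.exists_int {l : ℚ} {x y : Fin 4 → ℤ} (hy : IsPrimitiveVec y)
    (h : IsTwistedSq l (x 0 : ℚ) (x 1) (x 2) (x 3) (y 0) (y 1) (y 2) (y 3)) :
    ∃ m : ℤ, IsTwistedSq m (x 0) (x 1) (x 2) (x 3) (y 0) (y 1) (y 2) (y 3) := by
  have key : ∀ w z : ℤ, (w : ℚ) = l * z → (l.den : ℤ) ∣ z := by
    intro w z hwz
    have hd : (l.den : ℚ) ≠ 0 := by exact_mod_cast l.den_ne_zero
    have h' : (l.den * w : ℤ) = l.num * z := by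
      have : (l.den * w : ℚ) = l.num * z := by
        rw [hwz, ← mul_assoc, Rat.den_mul_eq_num]
      exact_mod_cast this
    have hc : IsCoprime (l.den : ℤ) l.num := by
      rw [Int.isCoprime_iff_gcd_eq_one, Int.gcd_comm]
      exact l.reduced
    exact hc.dvd_of_dvd_mul_left ⟨w, h'.symm⟩
  obtain ⟨e₀, e₁, e₂, e₃⟩ := h
  have d₀ := key (x 0 ^ 2 - x 2 ^ 2 - 2 * x 1 * x 3) (y 0) (by exact_mod_cast e₀)
  have d₁ := key (2 * x 0 * x 1 - 2 * x 2 * x 3) (y 2 - y 3) (by exact_mod_cast e₁)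
  have d₂ := key (2 * x 0 * x 2 + x 1 ^ 2 - x 3 ^ 2) (y 2 - y 1 - y 3) (by exact_mod_cast e₂)
  have d₃ := key (2 * x 0 * x 3 + 2 * x 1 * x 2) (y 2 - y 1) (by exact_mod_cast e₃)
  have hd := hy l.den (by
    intro i
    fin_cases i
    · exact d₀
    · simpa using dvd_sub d₁ d₂
    · have := dvd_sub (dvd_add d₁ d₃) d₂
      rwa [show y 2 - y 3 + (y 2 - y 1) - (y 2 - y 1 - y 3) = y 2 by ring] at this
    · simpa using dvd_sub d₃ d₂)
  have hd1 : l.den = 1 := by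
    rw [Int.isUnit_iff_natAbs_eq] at hd
    simpa using hd
  refine ⟨l.num, ?_⟩
  have hl : l = (l.num : ℚ) := ((Rat.den_eq_one_iff l).1 hd1).symm
  rw [hl] at e₀ e₁ e₂ e₃
  constructor
  · exact_mod_cast e₀
  · exact_mod_cast e₁
  · exact_mod_cast e₂
  · exact_mod_cast e₃

/-- The square of the Euclidean length. -/
def sqLength (y : Fin 4 → ℤ) : ℤ := y 0 ^ 2 + y 1 ^ 2 + y 2 ^ 2 + y 3 ^ 2

theorem sqLength_sq_le {l : ℤ} {x y : Fin 4 → ℤ} (hl : |l| ≤ 2)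
    (h : IsTwistedSq l (x 0) (x 1) (x 2) (x 3) (y 0) (y 1) (y 2) (y 3)) :
    sqLength x ^ 2 ≤ 24 * sqLength y := by
  obtain ⟨e₀, e₁, e₂, e₃⟩ := h
  unfold sqLength
  have hl4 : l ^ 2 ≤ 4 := by
    have := sq_le_sq' (neg_le_of_abs_le hl) (le_of_abs_le hl)
    linarith
  generalize x 0 = x₀ at *
  generalize x 1 = x₁ at *
  generalize x 2 = x₂ at *
  generalize x 3 = x₃ at *
  generalize y 0 = y₀ at *
  generalize y 1 = y₁ at *
  generalize y 2 = y₂ at *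
  generalize y 3 = y₃ at *
  have hid : (x₀ ^ 2 + x₁ ^ 2 + x₂ ^ 2 + x₃ ^ 2) ^ 2 +
      2 * (x₀ * x₁ + x₁ * x₂ + x₂ * x₃ - x₀ * x₃) ^ 2 =
      l ^ 2 * (y₀ ^ 2 + (y₂ - y₃) ^ 2 + (y₂ - y₁ - y₃) ^ 2 + (y₂ - y₁) ^ 2) := by
    have : (l * y₀) ^ 2 + (l * (y₂ - y₃)) ^ 2 + (l * (y₂ - y₁ - y₃)) ^ 2 + (l * (y₂ - y₁)) ^ 2 =
        l ^ 2 * (y₀ ^ 2 + (y₂ - y₃) ^ 2 + (y₂ - y₁ - y₃) ^ 2 + (y₂ - y₁) ^ 2) := by ring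
    rw [← this, ← e₀, ← e₁, ← e₂, ← e₃]
    ring
  have hΘ : y₀ ^ 2 + (y₂ - y₃) ^ 2 + (y₂ - y₁ - y₃) ^ 2 + (y₂ - y₁) ^ 2 ≤
      6 * (y₀ ^ 2 + y₁ ^ 2 + y₂ ^ 2 + y₃ ^ 2) := by
    nlinarith [sq_nonneg (y₁ + y₂), sq_nonneg (y₂ + y₃), sq_nonneg (y₁ - y₃), sq_nonneg y₀,
      sq_nonneg (2 * y₁ + 3 * y₂ + 2 * y₃), sq_nonneg (y₁ + y₂ + y₃)]
  calc (x₀ ^ 2 + x₁ ^ 2 + x₂ ^ 2 + x₃ ^ 2) ^ 2 ≤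
        l ^ 2 * (y₀ ^ 2 + (y₂ - y₃) ^ 2 + (y₂ - y₁ - y₃) ^ 2 + (y₂ - y₁) ^ 2) := by
        rw [← hid]
        nlinarith [sq_nonneg (x₀ * x₁ + x₁ * x₂ + x₂ * x₃ - x₀ * x₃)]
    _ ≤ 4 * (6 * (y₀ ^ 2 + y₁ ^ 2 + y₂ ^ 2 + y₃ ^ 2)) := by gcongr
    _ = _ := by ring

/-- The quartic equation of the Kummer surface, in the coordinates `yᵢ`. -/
def IsKummer {R : Type*} [CommRing R] (y₀ y₁ y₂ y₃ : R) : Prop :=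
  (((y₁ + y₃ - 2 * y₂) ^ 2 + 4 * y₁ * y₃) * (2 * y₀ - y₁ + y₃) -
    (y₁ ^ 2 * (y₁ + y₃ - 2 * y₂) - 4 * y₁ ^ 2 * y₃ + 4 * y₁ * y₃ ^ 2 -
      (y₁ + y₃ - 2 * y₂) * y₃ ^ 2)) ^ 2 =
  -4 * y₁ * y₃ * ((y₁ + y₃) ^ 2 + (y₁ + y₃ - 2 * y₂) ^ 2) *
    ((2 * y₁ + 2 * y₂ - 2 * y₃) ^ 2 - 2 * (y₁ - y₃ + 2 * y₂) ^ 2)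

instance (y₀ y₁ y₂ y₃ : ℤ) : Decidable (IsKummer y₀ y₁ y₂ y₃) := by
  unfold IsKummer
  infer_instance

theorem IsMumford.isKummer {t n a b : ℚ} (h : IsMumford t n a b) :
    IsKummer (kummer t n a + 1 + n) 2 (1 - t - n) (-2 * n) := by
  obtain ⟨h₁, h₂⟩ := h
  have hR : (((2 + -2 * n - 2 * (1 - t - n)) ^ 2 + 4 * 2 * (-2 * n)) *
      (2 * (kummer t n a + 1 + n) - 2 + -2 * n) -
      (2 ^ 2 * (2 + -2 * n - 2 * (1 - t - n)) - 4 * 2 ^ 2 * (-2 * n) + 4 * 2 * (-2 * n) ^ 2 -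
      (2 + -2 * n - 2 * (1 - t - n)) * (-2 * n) ^ 2)) = -16 * (a ^ 2 * n + a * b * t + b ^ 2) := by
    unfold kummer
    linear_combination 8 * t * h₁ + 16 * h₂
  unfold IsKummer
  rw [hR]
  have hN : (a ^ 2 * n + a * b * t + b ^ 2) ^ 2 =
      (a ^ 2 * t + 2 * a * b) ^ 2 * n + (a ^ 2 * t + 2 * a * b) * (b ^ 2 - a ^ 2 * n) * t +
        (b ^ 2 - a ^ 2 * n) ^ 2 := by ring
  rw [h₁, h₂] at hN
  linear_combination 256 * hN

theorem no_small_kummer : ∀ y₁ ∈ Finset.Icc (-4 : ℤ) 4, ∀ y₃ ∈ Finset.Icc (-4 : ℤ) 4,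
    y₁ ≠ 0 → y₃ ≠ 0 → y₁ + y₃ ≠ 0 → (∃ r ∈ Finset.Icc (0 : ℤ) 4, r * r = -(y₁ * y₃)) →
    ∀ y₀ ∈ Finset.Icc (-4 : ℤ) 4, ∀ y₂ ∈ Finset.Icc (-4 : ℤ) 4,
    y₀ ^ 2 + y₁ ^ 2 + y₂ ^ 2 + y₃ ^ 2 ≤ 24 → ¬ IsKummer y₀ y₁ y₂ y₃ := by
  decide +kernel

theorem Represents.isKummer {y : Fin 4 → ℤ} {t n a b : ℚ} (h : IsMumford t n a b)
    (hy : Represents y t n a) : IsKummer (y 0) (y 1) (y 2) (y 3) := by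
  obtain ⟨c, -, h₀, h₁, h₂, h₃⟩ := hy
  have hk := h.isKummer
  have : IsKummer (y 0 : ℚ) (y 1) (y 2) (y 3) := by
    unfold IsKummer at hk ⊢
    rw [h₀, h₁, h₂, h₃]
    linear_combination c ^ 6 * hk
  unfold IsKummer at this ⊢
  exact_mod_cast this

theorem IsGood.lt_sqLength {t n a b : ℚ} (h : IsGood t n a b) {y : Fin 4 → ℤ}
    (hy : Represents y t n a) : 24 < sqLength y := by
  by_contra! hle
  have hK := hy.isKummer h.isMumford
  obtain ⟨c, hc, h₀, h₁, h₂, h₃⟩ := hy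
  have hn0 : n ≠ 0 := by
    have := h.irreducible 0
    simpa using this
  obtain ⟨s, hs⟩ := h.isSquare
  have hb : ∀ z : ℤ, z ^ 2 ≤ 24 → z ∈ Finset.Icc (-4 : ℤ) 4 := by
    intro z hz
    rw [Finset.mem_Icc]
    constructor <;> nlinarith
  have hy1 : y 1 ≠ 0 := by
    have : (y 1 : ℚ) ≠ 0 := by rw [h₁]; positivity
    exact_mod_cast this
  have hy3 : y 3 ≠ 0 := by
    have : (y 3 : ℚ) ≠ 0 := by
      rw [h₃]
      exact mul_ne_zero hc (mul_ne_zero (by norm_num) hn0)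
    exact_mod_cast this
  have hy13 : y 1 + y 3 ≠ 0 := by
    have : (y 1 + y 3 : ℚ) ≠ 0 := by
      rw [h₁, h₃, show c * 2 + c * (-2 * n) = 2 * c * (1 - n) by ring]
      exact mul_ne_zero (by positivity) (sub_ne_zero.2 h.ne_one.symm)
    exact_mod_cast this
  unfold sqLength at hle
  have hsq : IsSquare (-(y 1 * y 3)) := by
    rw [← Rat.isSquare_intCast_iff]
    refine ⟨2 * c * s, ?_⟩
    push_cast
    rw [h₁, h₃, hs]
    ring
  obtain ⟨r, hr⟩ := hsq
  refine no_small_kummer (y 1) (hb _ (by nlinarith [sq_nonneg (y 0), sq_nonneg (y 2), sq_nonneg (y 3)]))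
    (y 3) (hb _ (by nlinarith [sq_nonneg (y 0), sq_nonneg (y 2), sq_nonneg (y 1)])) hy1 hy3 hy13
    ⟨|r|, ?_, by rw [abs_mul_abs_self, hr]⟩
    (y 0) (hb _ (by nlinarith [sq_nonneg (y 1), sq_nonneg (y 2), sq_nonneg (y 3)]))
    (y 2) (hb _ (by nlinarith [sq_nonneg (y 0), sq_nonneg (y 1), sq_nonneg (y 3)])) hle hK
  rw [Finset.mem_Icc]
  refine ⟨abs_nonneg r, ?_⟩
  have : r * r ≤ 12 := by
    rw [← hr]
    nlinarith [sq_nonneg (y 1 + y 3), sq_nonneg (y 0), sq_nonneg (y 2)]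
  by_contra! hlt
  nlinarith [abs_mul_abs_self r]

theorem IsGood.false {t n a b : ℚ} (h : IsGood t n a b) : False := by
  obtain ⟨y, hy, hprim⟩ := exists_represents t n a
  induction hN : (sqLength y).toNat using Nat.strong_induction_on generalizing t n a b y with
  | _ N ih =>
  have hlt := h.lt_sqLength hy
  obtain ⟨t', n', a', b', l, h', hD⟩ := h.exists_half
  obtain ⟨y', hy', hprim'⟩ := exists_represents t' n' a'
  have hT : ∃ l' : ℚ, IsTwistedSq l' (y' 0 : ℚ) (y' 1) (y' 2) (y' 3) (y 0) (y 1) (y 2) (y 3) := by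
    obtain ⟨c, hc, h₀, h₁, h₂, h₃⟩ := hy
    obtain ⟨c', hc', h₀', h₁', h₂', h₃'⟩ := hy'
    refine ⟨l * c' ^ 2 / c, ?_⟩
    rw [h₀, h₁, h₂, h₃, h₀', h₁', h₂', h₃']
    obtain ⟨e₀, e₁, e₂, e₃⟩ := hD
    constructor
    · field_simp
      linear_combination e₀
    · field_simp
      linear_combination e₁
    · field_simp
      linear_combination e₂
    · field_simp
      linear_combination e₃
  obtain ⟨l', hT⟩ := hT
  obtain ⟨m, hm⟩ := hT.exists_int hprim
  have hle := sqLength_sq_le (hm.abs_le_two hprim') hm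
  have hlt' := h'.lt_sqLength hy'
  refine ih (sqLength y').toNat ?_ h' y' hy' hprim' rfl
  rw [← hN, Int.toNat_lt_toNat (by linarith)]
  nlinarith

/-- Reduction of an effective divisor plus the point `(0, 0)`. -/
theorem IsMumford.translate {t n a b : ℚ} (h : IsMumford t n a b) (hn : n ≠ 0) :
    IsMumford (2 - (b / n) ^ 2 - t) (-1 / n) (a + b / n * (t - (2 - (b / n) ^ 2 - t)))
      (b / n * (-1 / n)) := by
  obtain ⟨h₁, h₂⟩ := h
  obtain ⟨β, rfl⟩ : ∃ β, b = β * n := ⟨b / n, by field_simp⟩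
  obtain ⟨k, hk⟩ : ∃ k, k * n = 1 := ⟨1 / n, by field_simp⟩
  have hk' : -1 / n = -k := by
    field_simp
    linear_combination hk
  rw [hk', mul_div_cancel_right₀ _ hn]
  have g₂ : β ^ 2 * n - a ^ 2 = t ^ 3 - 2 * t * n - 2 * t ^ 2 + 2 * n - 2 := by
    apply mul_left_cancel₀ hn
    linear_combination h₂
  have E₃ : 2 * β * (a + β * t) + n - k + t * (2 - β ^ 2 - t) = 0 := by
    apply mul_left_cancel₀ hn
    linear_combination h₁ + t * g₂ - hk
  have E₂ : 2 - (a + β * t) ^ 2 + t * k - (2 - β ^ 2 - t) * n = 0 := by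
    linear_combination g₂ - t * E₃
  constructor
  · linear_combination -(k + (2 - β ^ 2 - t) ^ 2) * E₃ - (2 - β ^ 2 - t) * E₂ + hk
  · linear_combination -k * (2 - β ^ 2 - t) * E₃ - k * E₂

theorem IsMumford.of_eq_neg_one {t n a b : ℚ} (h : IsMumford t n a b)
    (hirr : ∀ x : ℚ, x ^ 2 - t * x + n ≠ 0) (hn : n = -1) : t = 2 ∧ a = 0 ∧ b = 0 := by
  obtain ⟨h₁, h₂⟩ := h
  subst hn
  have hR : (b ^ 2 + a * b * t - a ^ 2) ^ 2 = (t - 2) ^ 2 * (t ^ 2 + 4) := by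
    have hN : (b ^ 2 + a * b * t - a ^ 2) ^ 2 =
      -(a ^ 2 * t + 2 * a * b) ^ 2 + (a ^ 2 * t + 2 * a * b) * (b ^ 2 - a ^ 2 * -1) * t +
        (b ^ 2 - a ^ 2 * -1) ^ 2 := by ring
    rw [h₁, h₂] at hN
    rw [hN]
    ring
  have ht : t = 2 := by
    by_contra ht
    have ht' : t - 2 ≠ 0 := sub_ne_zero.2 ht
    apply hirr ((t + (b ^ 2 + a * b * t - a ^ 2) / (t - 2)) / 2)
    field_simp
    linear_combination hR
  subst ht
  have hab : b ^ 2 + a ^ 2 = 0 := by linear_combination h₂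
  refine ⟨rfl, ?_, ?_⟩ <;> nlinarith [sq_nonneg a, sq_nonneg b]

theorem IsMumford.roots {t n a b x : ℚ} (h : IsMumford t n a b) (hx : x ^ 2 - t * x + n = 0) :
    ∃ x y : ℚ, (x = 0 ∨ x = 1 ∨ x = -1) ∧ (y = 0 ∨ y = 1 ∨ y = -1) ∧ t = x + y ∧ n = x * y :=
  ⟨x, t - x, h.root hx, h.root (by linear_combination hx), by ring, by linear_combination hx⟩

theorem IsMumford.of_eq_one {t n a b : ℚ} (h : IsMumford t n a b)
    (hirr : ∀ x : ℚ, x ^ 2 - t * x + n ≠ 0) (hn : n = 1) : t = 0 ∧ a = 0 ∧ b = 0 := by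
  subst hn
  have h' := h.translate one_ne_zero
  simp only [div_one] at h'
  have hr := hirr 1
  have hr' := hirr (-1)
  by_cases hx : ∀ x : ℚ, x ^ 2 - (2 - b ^ 2 - t) * x + -1 ≠ 0
  · obtain ⟨ht, ha, hb⟩ := h'.of_eq_neg_one hx rfl
    have hb0 : b = 0 := by linear_combination -hb
    subst hb0
    exact ⟨by linear_combination -ht, by linear_combination ha, rfl⟩
  · push Not at hx
    obtain ⟨x, hx⟩ := hx
    obtain ⟨x, y, hx, hy, ht, hn⟩ := h'.roots hx
    have ht0 : 2 - b ^ 2 - t = 0 := by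
      rw [ht]
      rcases hx with rfl | rfl | rfl <;> rcases hy with rfl | rfl | rfl <;>
        first | (norm_num; done) | exact absurd hn (by norm_num)
    have c₁ := h'.curve (x := (1 : ℚ)) (by rw [ht0]; norm_num)
    have c₂ := h'.curve (x := (-1 : ℚ)) (by rw [ht0]; norm_num)
    simp only [Rat.cast_id] at c₁ c₂
    have hab : b * (b ^ 2 - 4) = 0 := by grind
    grind

/-- Reduction of an effective divisor plus the points with `x ^ 2 + 1 = 0`. -/
theorem IsMumford.exists_translate {t n a b : ℚ} (h : IsMumford t n a b)
    (hS : (n - 1) ^ 2 + t ^ 2 ≠ 0) :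
    ∃ e f p r : ℚ, p = -(1 + 2 * e * f) - e ^ 2 * t ∧ r = 2 - e ^ 2 - f ^ 2 + t * p + e ^ 2 * n ∧
      n * p - t * r = 1 - 2 * e * f ∧ n * r = -f ^ 2 := by
  obtain ⟨h₁, h₂⟩ := h
  obtain ⟨e, f, ha, hb⟩ : ∃ e f : ℚ, a = e * t ^ 2 + t * f + (1 - n) * e ∧
      b = (1 - n) * f - e * t * n := by
    refine ⟨((1 - n) * a - t * b) / ((n - 1) ^ 2 + t ^ 2),
      ((t ^ 2 + 1 - n) * b + t * n * a) / ((n - 1) ^ 2 + t ^ 2), ?_, ?_⟩ <;>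
    · field_simp
      ring
  subst ha hb
  refine ⟨e, f, _, _, rfl, rfl, ?_⟩
  set p := -(1 + 2 * e * f) - e ^ 2 * t with hp
  set r := 2 - e ^ 2 - f ^ 2 + t * p + e ^ 2 * n with hr
  set g₁ := 1 - 2 * e * f - (n * p - t * r) with hg₁
  set g₀ := -f ^ 2 - n * r with hg₀
  have e₁ : g₁ * (t ^ 2 + 1 - n) + t * g₀ = 0 := by
    simp only [hg₁, hg₀, hr, hp]
    linear_combination -h₁
  have e₀ : (1 - n) * g₀ - g₁ * t * n = 0 := by
    simp only [hg₁, hg₀, hr, hp]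
    linear_combination -h₂
  have z₁ : g₁ = 0 := by
    apply mul_left_cancel₀ hS
    linear_combination (1 - n) * e₁ - t * e₀
  have z₀ : g₀ = 0 := by
    apply mul_left_cancel₀ hS
    linear_combination (t ^ 2 + 1 - n) * e₀ + t * n * e₁
  exact ⟨by linear_combination -z₁, by linear_combination -z₀⟩

theorem IsMumford.of_translate {t n e f T N : ℚ}
    (h₃ : e ^ 2 * T = -(1 + 2 * e * f) - e ^ 2 * t)
    (h₂ : -(e ^ 2 * N) = 2 - e ^ 2 - f ^ 2 + t * (e ^ 2 * T) + e ^ 2 * n)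
    (h₁ : n * (e ^ 2 * T) + t * (e ^ 2 * N) = 1 - 2 * e * f) (h₀ : n * (e ^ 2 * N) = f ^ 2) :
    IsMumford T N (e * T ^ 2 + T * f + (1 - N) * e) ((1 - N) * f - e * T * N) := by
  have g₁ : 1 - 2 * e * f - (N * (-(1 + 2 * e * f) - e ^ 2 * T) - T * (2 - e ^ 2 - f ^ 2 +
      T * (-(1 + 2 * e * f) - e ^ 2 * T) + e ^ 2 * N)) = 0 := by
    linear_combination -h₁ - (T ^ 2 - N) * h₃ - T * h₂
  have g₀ : -f ^ 2 - N * (2 - e ^ 2 - f ^ 2 +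
      T * (-(1 + 2 * e * f) - e ^ 2 * T) + e ^ 2 * N) = 0 := by
    linear_combination h₀ + N * h₂ + N * T * h₃
  constructor
  · linear_combination -(T ^ 2 + 1 - N) * g₁ - T * g₀
  · linear_combination -(1 - N) * g₀ + T * N * g₁

theorem IsMumford.exists_isGood {t n a b : ℚ} (h : IsMumford t n a b)
    (hirr : ∀ x : ℚ, x ^ 2 - t * x + n ≠ 0) (hn : n ≠ 1) (hn' : n ≠ -1) (hsq : IsSquare n)
    (hsq' : IsSquare (2 * ((n - 1) ^ 2 + t ^ 2))) : ∃ t' n' a' b' : ℚ, IsGood t' n' a' b' := by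
  have hn0 : n ≠ 0 := by simpa using hirr 0
  have hS : 0 < (n - 1) ^ 2 + t ^ 2 := by
    have := sub_ne_zero.2 hn
    positivity
  obtain ⟨e, f, p, r, hp, hr, h₁, h₀⟩ := h.exists_translate hS.ne'
  have he : e ≠ 0 := by
    rintro rfl
    have hr' : r = 0 ∨ r = 1 ∨ r = -1 := by
      apply rational_points (v := f * (r ^ 2 + 1))
      grind
    rcases hr' with rfl | rfl | rfl
    · exact hn' (by linear_combination n * hp - h₁)
    · exact hn' (by grind)
    · exact hn (by grind)
  obtain ⟨T, hT⟩ : ∃ T, p = e ^ 2 * T := ⟨p / e ^ 2, by field_simp⟩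
  obtain ⟨N, hN⟩ : ∃ N, r = -(e ^ 2 * N) := ⟨-r / e ^ 2, by field_simp⟩
  subst hT hN
  have h' := IsMumford.of_translate hp hr (by linear_combination h₁) (by linear_combination -h₀)
  have hSS : e ^ 4 * ((n - 1) ^ 2 + t ^ 2) * ((N - 1) ^ 2 + T ^ 2) = 8 := by
    have hA : e ^ 2 * ((n - 1) * (N - 1) - t * T) = 2 := by linear_combination -h₀ + hr
    have hB : e ^ 2 * (t * (N - 1) + T * (n - 1)) = 2 := by linear_combination h₁ - hp
    linear_combination (e ^ 2 * ((n - 1) * (N - 1) - t * T) + 2) * hA +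
      (e ^ 2 * (t * (N - 1) + T * (n - 1)) + 2) * hB
  have hirr' : ∀ x : ℚ, x ^ 2 - T * x + N ≠ 0 := by
    intro z hz
    obtain ⟨x, y, hx, hy, rfl, rfl⟩ := h'.roots hz
    clear hz h' hsq hsq' h hirr
    rcases hx with rfl | rfl | rfl <;> rcases hy with rfl | rfl | rfl
    all_goals grind
  refine ⟨_, _, _, _, h', hirr', ?_, ?_, ?_⟩
  · intro hN1
    obtain ⟨hT0, -, -⟩ := h'.of_eq_one hirr' hN1
    rw [hN1, hT0] at hSS
    norm_num at hSS
  · obtain ⟨s, rfl⟩ := hsq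
    have hs : s ≠ 0 := by simpa using hn0
    refine ⟨f / (e * s), ?_⟩
    field_simp
    linear_combination -h₀
  · obtain ⟨w, hw⟩ := hsq'
    have hw0 : w ≠ 0 := by
      rintro rfl
      linarith
    refine ⟨4 / (e ^ 2 * w), ?_⟩
    field_simp
    linear_combination 2 * hSS - e ^ 4 * ((N - 1) ^ 2 + T ^ 2) * hw

theorem IsMumford.eq_one_or_eq_neg_one {t n a b : ℚ} (h : IsMumford t n a b)
    (hirr : ∀ x : ℚ, x ^ 2 - t * x + n ≠ 0) : n = 1 ∨ n = -1 := by
  by_contra! hne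
  wlog hpos : 0 < n generalizing t n a b
  · have hn0 : n ≠ 0 := by simpa using hirr 0
    have hneg : n < 0 := lt_of_le_of_ne (not_lt.1 hpos) hn0
    have h' := h.translate hn0
    have hN1 : -1 / n ≠ 1 := by
      intro h
      field_simp at h
      grind
    have hN2 : -1 / n ≠ -1 := by
      intro h
      field_simp at h
      grind
    refine this h' ?_ ⟨hN1, hN2⟩ (div_pos_of_neg_of_neg (by norm_num) hneg)
    intro x hx
    obtain ⟨x, y, hx, hy, -, hN⟩ := h'.roots hx
    have hN0 : -1 / n ≠ 0 := div_ne_zero (by norm_num) hn0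
    rw [hN] at hN0 hN1 hN2
    rcases hx with rfl | rfl | rfl <;> rcases hy with rfl | rfl | rfl <;> norm_num at *
  obtain ⟨h₁, h₂⟩ := h.isSquare hirr hne.1 hne.2
  rw [abs_of_pos hpos] at h₁
  rcases h₂ with h₂ | h₂
  · exact IsGood.false ⟨h, hirr, hne.1, h₁, h₂⟩
  · obtain ⟨t', n', a', b', h'⟩ := h.exists_isGood hirr hne.1 hne.2 h₁ h₂
    exact h'.false

theorem IsMumford.eq_zero {t n a b : ℚ} (h : IsMumford t n a b)
    (hirr : ∀ x : ℚ, x ^ 2 - t * x + n ≠ 0) : a = 0 ∧ b = 0 := by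
  rcases h.eq_one_or_eq_neg_one hirr with hn | hn
  · exact (h.of_eq_one hirr hn).2
  · exact (h.of_eq_neg_one hirr hn).2

theorem exists_eq_mul_add {K : Type*} [Field K] [CharZero K] (hdeg : Module.finrank ℚ K = 2) {u : K}
    (hu : ∀ q : ℚ, (q : K) ≠ u) (w : K) : ∃ a b : ℚ, w = a * u + b := by
  have hspan := (linearIndependent_one_of_irrational hu).span_eq_top_of_card_eq_finrank (by simp [hdeg])
  have hw : w ∈ Submodule.span ℚ (Set.range ![1, u]) := hspan ▸ Submodule.mem_top
  simp only [Matrix.range_cons, Matrix.range_empty, Set.union_empty, Set.singleton_union] at hw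
  obtain ⟨a, b, rfl⟩ := Submodule.mem_span_pair.1 hw
  refine ⟨b, a, ?_⟩
  simp only [Algebra.smul_def, eq_ratCast]
  ring

theorem exists_ratCast_eq_of_curve {K : Type*} [Field K] [CharZero K]
    (hdeg : Module.finrank ℚ K = 2) {u v : K}
    (h : v ^ 2 = -u * (u ^ 2 + 1) * (u ^ 2 - 2 * u - 1)) (hv : v ≠ 0) : ∃ q : ℚ, (q : K) = u := by
  by_contra! hu
  obtain ⟨t, m, ht⟩ := exists_eq_mul_add hdeg hu (u ^ 2)
  obtain ⟨a, b, rfl⟩ := exists_eq_mul_add hdeg hu v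
  have hzero : ∀ p q : ℚ, (p * u + q : K) = 0 → p = 0 ∧ q = 0 := fun _ _ =>
    eq_zero_of_mul_add_eq_zero hu
  have hM : IsMumford t (-m) a b := by
    obtain ⟨h₁, h₂⟩ := hzero
      (a ^ 2 * t + 2 * a * b - (-t ^ 4 + 3 * t ^ 2 * (-m) - (-m) ^ 2 + 2 * t ^ 3 - 4 * t * (-m) +
        2 * t + 1))
      (b ^ 2 - a ^ 2 * (-m) - (t ^ 3 * (-m) - 2 * t * (-m) ^ 2 - 2 * t ^ 2 * (-m) + 2 * (-m) ^ 2 -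
        2 * (-m))) (by
        push_cast
        linear_combination h - (a ^ 2 + u ^ 3 + t * u ^ 2 + (t ^ 2 + m) * u + t ^ 3 + 2 * t * m
          - 2 * (u ^ 2 + t * u + t ^ 2 + m) - 2) * ht)
    exact ⟨sub_eq_zero.1 h₁, sub_eq_zero.1 h₂⟩
  have hirr : ∀ x : ℚ, x ^ 2 - t * x + -m ≠ 0 := by
    intro x hx
    have hx' : (x ^ 2 - t * x + -m : K) = 0 := by exact_mod_cast hx
    have : (u - x) * (u - (t - x : ℚ)) = 0 := by
      push_cast
      linear_combination ht - hx'
    rcases mul_eq_zero.1 this with h | h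
    · exact hu x (sub_eq_zero.1 h).symm
    · exact hu _ (sub_eq_zero.1 h).symm
  obtain ⟨rfl, rfl⟩ := hM.eq_zero hirr
  simp at hv

/-- A lemma of Thue. -/
theorem exists_small_dvd (a b : ℤ) {c : ℕ} (hc : 0 < c) :
    ∃ s t : ℤ, (s ≠ 0 ∨ t ≠ 0) ∧ s ^ 2 ≤ c ∧ t ^ 2 ≤ c ∧ (c : ℤ) ∣ s * b - t * a := by
  have : NeZero c := ⟨hc.ne'⟩
  set k := Nat.sqrt c with hk
  have hcard : (Finset.univ : Finset (ZMod c)).card <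
      (Finset.range (k + 1) ×ˢ Finset.range (k + 1)).card := by
    rw [Finset.card_univ, ZMod.card, Finset.card_product, Finset.card_range]
    exact Nat.lt_succ_sqrt c
  obtain ⟨⟨x, y⟩, hx, ⟨x', y'⟩, hx', hne, heq⟩ :=
    Finset.exists_ne_map_eq_of_card_lt_of_maps_to hcard
      (f := fun z => (z.1 * b - z.2 * a : ZMod c)) (fun _ _ => Finset.mem_univ _)
  simp only [Finset.mem_product, Finset.mem_range, Nat.lt_succ_iff] at hx hx'
  have hk2 : (k * k : ℤ) ≤ c := by exact_mod_cast Nat.sqrt_le c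
  have hb : ∀ i j : ℕ, i ≤ k → j ≤ k → ((i : ℤ) - j) ^ 2 ≤ c := by
    intro i j hi hj
    zify at hi hj
    nlinarith
  refine ⟨x - x', y - y', ?_, hb _ _ hx.1 hx'.1, hb _ _ hx.2 hx'.2, ?_⟩
  · by_contra! h
    apply hne
    ext
    · exact_mod_cast sub_eq_zero.1 h.1
    · exact_mod_cast sub_eq_zero.1 h.2
  · rw [← ZMod.intCast_zmod_eq_zero_iff_dvd]
    push_cast
    linear_combination heq

theorem exists_sq_add_three_mul_sq {a b c : ℤ} (hc : Odd c) (hc0 : 0 < c) (h3 : ¬ 3 ∣ c)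
    (hb : IsCoprime b c) (h : c ∣ a ^ 2 + 3 * b ^ 2) :
    ∃ s t : ℤ, s ^ 2 + 3 * t ^ 2 = c ∧ c ∣ s * b - t * a := by
  rcases eq_or_ne c 1 with rfl | hc1
  · exact ⟨1, 0, by norm_num, one_dvd _⟩
  have ha : IsCoprime a c := by
    have h3c : IsCoprime (3 : ℤ) c := (Int.prime_three.coprime_iff_not_dvd).2 h3
    have h1 : IsCoprime (3 * b ^ 2) c := IsCoprime.mul_left h3c (hb.pow_left)
    obtain ⟨d, hd⟩ := h
    have h2 : IsCoprime (a ^ 2) c := by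
      have := h1.neg_left.add_mul_right_left d
      rwa [show -(3 * b ^ 2) + d * c = a ^ 2 by linear_combination -hd] at this
    exact (IsCoprime.pow_left_iff two_pos).1 h2
  obtain ⟨s, t, hne, hs, ht, hd⟩ := exists_small_dvd a b (c := c.toNat) (by omega)
  rw [Int.toNat_of_nonneg hc0.le] at hs ht hd
  have hdvd : c ∣ s ^ 2 + 3 * t ^ 2 := by
    have : c ∣ b ^ 2 * (s ^ 2 + 3 * t ^ 2) := by
      have h1 := (hd.mul_left (s * b + t * a)).add (h.mul_left (t ^ 2))
      rwa [show (s * b + t * a) * (s * b - t * a) + t ^ 2 * (a ^ 2 + 3 * b ^ 2) =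
        b ^ 2 * (s ^ 2 + 3 * t ^ 2) by ring] at h1
    exact (hb.symm.pow_right).dvd_of_dvd_mul_left this
  obtain ⟨m, hm⟩ := hdvd
  have hpos : 0 < s ^ 2 + 3 * t ^ 2 := by
    rcases hne with hne | hne <;> positivity
  have hm0 : 0 < m := by
    rw [hm] at hpos
    exact pos_of_mul_pos_right hpos hc0.le
  have hm4 : m ≤ 4 := by
    by_contra! hlt
    nlinarith
  obtain ⟨k, hk⟩ := hc
  interval_cases m
  · exact ⟨s, t, by linarith, hd⟩
  · exfalso
    rcases Int.even_or_odd' s with ⟨i, rfl | rfl⟩ <;> rcases Int.even_or_odd' t with ⟨j, rfl | rfl⟩ <;>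
      ring_nf at hm <;> omega
  · obtain ⟨r, rfl⟩ : 3 ∣ s := Int.prime_three.dvd_of_dvd_pow (n := 2) ⟨c - t ^ 2, by linarith⟩
    refine ⟨t, -r, by linarith, ?_⟩
    apply ha.symm.dvd_of_dvd_mul_left
    have h1 := (h.mul_left r).sub (hd.mul_left b)
    rwa [show r * (a ^ 2 + 3 * b ^ 2) - b * (3 * r * b - t * a) = a * (t * b - -r * a) by ring] at h1
  · exfalso
    have hs' : s ^ 2 = c := by linarith
    have ht' : t ^ 2 = c := by linarith
    have hcop : IsCoprime s b := by
      rw [← hs'] at hb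
      exact ((IsCoprime.pow_right_iff two_pos).1 hb).symm
    have hst : s ∣ t := by
      rw [← Int.pow_dvd_pow_iff two_ne_zero, hs', ht']
    obtain ⟨e, rfl⟩ := hst
    have he : e ^ 2 = 1 := by
      have : s ^ 2 ≠ 0 := by rw [hs']; exact hc0.ne'
      apply mul_left_cancel₀ this
      linarith
    have h1 : s ∣ b - e * a := by
      have hs0 : s ≠ 0 := by
        rintro rfl
        simp at hs'
        omega
      rw [← mul_dvd_mul_iff_left hs0]
      rw [← hs', pow_two] at hd
      rwa [show s * (b - e * a) = s * b - s * e * a by ring]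
    have h2 : s ∣ 4 * b ^ 2 := by
      have h3 := (dvd_trans (Dvd.intro_left s (by rw [← hs']; ring)) h : s ∣ a ^ 2 + 3 * b ^ 2).add
        (h1.mul_left (b + e * a))
      rwa [show a ^ 2 + 3 * b ^ 2 + (b + e * a) * (b - e * a) = 4 * b ^ 2 by
        linear_combination -a ^ 2 * he] at h3
    have h4 : s ∣ 4 := hcop.pow_right.dvd_of_dvd_mul_right h2
    have : s ≤ 4 := Int.le_of_dvd (by norm_num) h4
    have : -s ≤ 4 := Int.le_of_dvd (by norm_num) (by rwa [neg_dvd])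
    have hsl : -4 ≤ s := by linarith
    interval_cases s <;> omega

/-- Division by `s + t √-3`. -/
theorem exists_quotient {a b c s t : ℤ} (hc0 : c ≠ 0) (hst : s ^ 2 + 3 * t ^ 2 = c)
    (hb : IsCoprime b c) (h : c ∣ a ^ 2 + 3 * b ^ 2) (hd : c ∣ s * b - t * a) :
    ∃ a' b' : ℤ, a = s * a' - 3 * t * b' ∧ b = s * b' + t * a' := by
  obtain ⟨b', hb'⟩ := hd
  have : c ∣ s * a + 3 * t * b := by
    apply hb.symm.dvd_of_dvd_mul_right
    have h1 := (h.mul_left t).add ((Dvd.intro b' hb'.symm).mul_left a)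
    rwa [show t * (a ^ 2 + 3 * b ^ 2) + a * (s * b - t * a) = (s * a + 3 * t * b) * b by ring] at h1
  obtain ⟨a', ha'⟩ := this
  refine ⟨a', b', ?_, ?_⟩
  · apply mul_left_cancel₀ hc0
    linear_combination s * ha' - 3 * t * hb' - a * hst
  · apply mul_left_cancel₀ hc0
    linear_combination s * hb' + t * ha' - b * hst

theorem exists_cube_form {a b c : ℤ} (h : a ^ 2 + 3 * b ^ 2 = c ^ 3) (hab : IsCoprime a b)
    (hc : Odd c) (h3 : ¬ 3 ∣ c) :
    ∃ s t : ℤ, a = s * (s ^ 2 - 9 * t ^ 2) ∧ b = 3 * t * (s ^ 2 - t ^ 2) := by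
  have hc0 : 0 < c := by
    have hne : c ≠ 0 := by
      rintro rfl
      simp at hc
    have : 0 ≤ c ^ 3 := by rw [← h]; positivity
    exact lt_of_le_of_ne ((Odd.pow_nonneg_iff (by decide)).1 this) hne.symm
  have hcop : ∀ a b k : ℤ, IsCoprime a b → a ^ 2 + 3 * b ^ 2 = c * k → IsCoprime b c := by
    intro a b k hab hk
    have := (hab.symm.pow_right (n := 2)).add_mul_left_right (3 * b)
    rw [show a ^ 2 + b * (3 * b) = c * k by linear_combination hk] at this
    exact this.of_mul_right_left
  obtain ⟨s, t, hst, hd⟩ := exists_sq_add_three_mul_sq hc hc0 h3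
    (hcop a b (c ^ 2) hab (by rw [h]; ring)) (h ▸ dvd_pow_self c three_ne_zero)
  have hquot : ∀ a b k : ℤ, IsCoprime a b → a ^ 2 + 3 * b ^ 2 = c * k → c ∣ s * b - t * a →
      ∃ a' b' : ℤ, a = s * a' - 3 * t * b' ∧ b = s * b' + t * a' ∧ IsCoprime a' b' ∧
        a' ^ 2 + 3 * b' ^ 2 = k ∧ (c ∣ k → c ∣ s * b' - t * a') := by
    intro a b k hab hk hd
    have hb := hcop a b k hab hk
    obtain ⟨a', b', rfl, rfl⟩ := exists_quotient hc0.ne' hst hb ⟨k, hk⟩ hd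
    have hk' : a' ^ 2 + 3 * b' ^ 2 = k := by
      apply mul_left_cancel₀ hc0.ne'
      rw [← hk, ← hst]
      ring
    refine ⟨a', b', rfl, rfl, ?_, hk', ?_⟩
    · obtain ⟨u, v, huv⟩ := hab
      exact ⟨u * s + v * t, v * s - 3 * u * t, by linear_combination huv⟩
    · rintro ⟨k', rfl⟩
      apply hb.symm.dvd_of_dvd_mul_left
      exact ⟨b' ^ 2 - t ^ 2 * k', by linear_combination b' ^ 2 * hst - t ^ 2 * hk'⟩
  obtain ⟨a₁, b₁, rfl, rfl, hab₁, h₁, hd₁⟩ := hquot a b (c ^ 2) hab (by rw [h]; ring) hd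
  obtain ⟨a₂, b₂, rfl, rfl, hab₂, h₂, hd₂⟩ :=
    hquot a₁ b₁ c hab₁ (by rw [h₁]; ring) (hd₁ (dvd_pow_self c two_ne_zero))
  obtain ⟨a₃, b₃, rfl, rfl, -, h₃, -⟩ := hquot a₂ b₂ 1 hab₂ (by rw [h₂]; ring) (hd₂ dvd_rfl)
  obtain rfl : b₃ = 0 := by
    by_contra hb
    have : 0 < b₃ ^ 2 := by positivity
    nlinarith [sq_nonneg a₃]
  rcases (sq_eq_one_iff (R := ℤ)).1 (show a₃ ^ 2 = 1 by linarith) with rfl | rfl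
  · exact ⟨s, t, by ring, by ring⟩
  · exact ⟨-s, -t, by ring, by ring⟩

theorem cube_add_cube_mod_nine : ∀ x y z : ZMod 9, x ^ 3 + y ^ 3 = 4 * z ^ 3 → 3 * (x + y) = 0 := by
  decide +kernel

/-- One step of the descent for `x ^ 3 + y ^ 3 = 4 * z ^ 3`. -/
theorem exists_smaller_cubes {x y z : ℤ} (h : x ^ 3 + y ^ 3 = 4 * z ^ 3) (hz : z ≠ 0)
    (hxy : IsCoprime x y) :
    ∃ x' y' z' : ℤ, x' ^ 3 + y' ^ 3 = 4 * z' ^ 3 ∧ z' ≠ 0 ∧ z'.natAbs < z.natAbs := by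
  have hodd : Odd x ∧ Odd y := by
    have hpar : Even (x ^ 3 + y ^ 3) := ⟨2 * z ^ 3, by linarith⟩
    have hnot : ¬ (Even x ∧ Even y) := by
      rintro ⟨hx, hy⟩
      exact Int.prime_two.not_isUnit (hxy.isUnit_of_dvd' hx.two_dvd hy.two_dvd)
    rw [Int.even_add, Int.even_pow' three_ne_zero, Int.even_pow' three_ne_zero] at hpar
    rw [← Int.not_even_iff_odd, ← Int.not_even_iff_odd]
    tauto
  obtain ⟨p, hp⟩ : Even (x + y) := hodd.1.add_odd hodd.2
  obtain ⟨q, rfl⟩ : ∃ q, x = p + q := ⟨x - p, by ring⟩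
  obtain rfl : y = p - q := by linarith
  have hpq : IsCoprime p q := by
    obtain ⟨u, v, huv⟩ := hxy
    exact ⟨u + v, u - v, by linear_combination huv⟩
  have hprod : p * (p ^ 2 + 3 * q ^ 2) = 2 * z ^ 3 := by linarith
  have hp2 : Even p := by
    by_contra hp
    rw [Int.not_even_iff_odd] at hp
    have hq : Even q := by
      have := hodd.1
      rw [Int.odd_add] at this
      exact this.1 hp
    have : Odd (p * (p ^ 2 + 3 * q ^ 2)) :=
      hp.mul (hp.pow.add_even ((hq.pow_of_ne_zero two_ne_zero).mul_left 3))
    rw [hprod] at this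
    exact Int.not_even_iff_odd.2 this (even_two_mul _)
  have hp3 : 3 ∣ p := by
    have h9 := cube_add_cube_mod_nine (p + q : ℤ) (p - q : ℤ) z (by exact_mod_cast congrArg _ h)
    have h9' : ((3 * (p + q + (p - q)) : ℤ) : ZMod 9) = 0 := by exact_mod_cast h9
    rw [ZMod.intCast_zmod_eq_zero_iff_dvd] at h9'
    push_cast at h9'
    omega
  obtain ⟨p, rfl⟩ := hp3
  have hz3 : 3 ∣ z := by
    have h1 : (3 : ℤ) ∣ 2 * z ^ 3 := ⟨p * ((3 * p) ^ 2 + 3 * q ^ 2), by rw [← hprod]; ring⟩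
    rcases Int.prime_three.dvd_or_dvd h1 with h1 | h1
    · norm_num at h1
    · exact Int.prime_three.dvd_of_dvd_pow h1
  obtain ⟨z, rfl⟩ := hz3
  have hprod' : p * (q ^ 2 + 3 * p ^ 2) = 6 * z ^ 3 := by linarith
  have hq3 : ¬ 3 ∣ q := fun hq =>
    Int.prime_three.not_isUnit (hpq.isUnit_of_dvd' (dvd_mul_right 3 p) hq)
  have hp3 : 3 ∣ p := by
    have h1 : (3 : ℤ) ∣ p * q ^ 2 := ⟨2 * z ^ 3 - p ^ 3, by linarith⟩
    exact (Int.prime_three.dvd_or_dvd h1).resolve_right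
      fun h2 => hq3 (Int.prime_three.dvd_of_dvd_pow h2)
  have hq2 : Odd q := by
    have := hodd.1
    rw [Int.odd_add] at this
    by_contra hq
    exact Int.not_even_iff_odd.2 (this.2 (Int.not_odd_iff_even.1 hq)) hp2
  obtain ⟨r, rfl⟩ : 6 ∣ p := by
    have := hp2.two_dvd
    omega
  have hqr : IsCoprime q (6 * r) := hpq.symm.of_mul_right_right
  have hcopr : IsCoprime r (q ^ 2 + 3 * (6 * r) ^ 2) := by
    have := (hqr.of_mul_right_right.symm.pow_right (n := 2)).add_mul_left_right (108 * r)
    rwa [show q ^ 2 + r * (108 * r) = q ^ 2 + 3 * (6 * r) ^ 2 by ring] at this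
  obtain ⟨⟨A, hA⟩, ⟨B, hB⟩⟩ := Int.eq_pow_of_mul_eq_pow_odd hcopr (k := 3) (c := z) (by decide)
    (by linarith)
  have hBodd : Odd B := by
    have : Odd (B ^ 3) := by
      rw [← hB]
      exact hq2.pow.add_even ⟨54 * r ^ 2, by ring⟩
    exact (Int.odd_pow' three_ne_zero).1 this
  have hB3 : ¬ 3 ∣ B := by
    rintro ⟨k, rfl⟩
    apply hq3
    exact Int.prime_three.dvd_of_dvd_pow (n := 2) ⟨9 * k ^ 3 - 36 * r ^ 2, by linarith⟩
  obtain ⟨s, t, hs, ht⟩ := exists_cube_form hB hqr hBodd hB3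
  have hst : IsCoprime s t := by
    rw [hs, ht] at hqr
    exact hqr.of_mul_left_left.of_mul_right_left.of_mul_right_right
  rw [hs, Int.odd_mul] at hq2
  obtain ⟨t, rfl⟩ : 2 ∣ t := by
    by_contra h2
    have : Odd t := by
      rw [← Int.not_even_iff_odd, even_iff_two_dvd]
      exact h2
    exact Int.not_even_iff_odd.2 hq2.2 (hq2.1.pow.sub_odd (Odd.mul (by decide) this.pow))
  have hprod'' : t * ((s - 2 * t) * (s + 2 * t)) = A ^ 3 := by
    rw [hA] at ht
    linarith
  have c₁ : IsCoprime t s := hst.symm.of_mul_left_right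
  have c₂ : IsCoprime (s - 2 * t) (s + 2 * t) := by
    have h1 : IsCoprime (s - 2 * t) (2 * (2 * t)) := by
      apply IsCoprime.mul_right
      · refine ((Int.prime_two.coprime_iff_not_dvd).2 fun h => ?_).symm
        exact Int.not_even_iff_odd.2 (hq2.1.sub_even (even_two_mul t)) (even_iff_two_dvd.2 h)
      · have := hst.symm.add_mul_left_right (-1)
        rw [show s + 2 * t * -1 = s - 2 * t by ring] at this
        exact this.symm
    have := h1.add_mul_left_right 1
    rwa [show 2 * (2 * t) + (s - 2 * t) * 1 = s + 2 * t by ring] at this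
  have c₃ : IsCoprime t ((s - 2 * t) * (s + 2 * t)) := by
    apply IsCoprime.mul_right
    · have := c₁.add_mul_left_right (-2)
      rwa [show s + t * -2 = s - 2 * t by ring] at this
    · have := c₁.add_mul_left_right 2
      rwa [show s + t * 2 = s + 2 * t by ring] at this
  obtain ⟨⟨α, hα⟩, ⟨D, hD⟩⟩ := Int.eq_pow_of_mul_eq_pow_odd c₃ (by decide) hprod''
  obtain ⟨⟨β, hβ⟩, ⟨γ, hγ⟩⟩ := Int.eq_pow_of_mul_eq_pow_odd c₂ (by decide) hD
  have hz0 : z ≠ 0 := by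
    rintro rfl
    simp at hz
  have hαz : α ∣ z := by
    have h1 : α ^ 3 ∣ z ^ 3 := by
      have : z ^ 3 = A ^ 3 * B ^ 3 := by
        rw [← hA, ← hB]
        linarith
      rw [this, ← hprod'', hα]
      exact (dvd_mul_right _ _).mul_right _
    exact (Int.pow_dvd_pow_iff three_ne_zero).1 h1
  refine ⟨γ, -β, α, ?_, ?_, ?_⟩
  · linear_combination hβ - hγ + 4 * hα
  · rintro rfl
    exact hz0 (zero_dvd_iff.1 hαz)
  · have := Nat.le_of_dvd (Int.natAbs_pos.2 hz0) (Int.natAbs_dvd_natAbs.2 hαz)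
    rw [Int.natAbs_mul]
    have := Int.natAbs_pos.2 hz0
    simp only [Int.reduceAbs]
    omega

theorem eq_zero_of_cube_add_cube {x y z : ℤ} (h : x ^ 3 + y ^ 3 = 4 * z ^ 3) : z = 0 := by
  induction hN : z.natAbs using Nat.strong_induction_on generalizing x y z with
  | _ N ih =>
  subst hN
  by_contra hz
  by_cases hxy : IsCoprime x y
  · obtain ⟨x', y', z', h', hz', hlt⟩ := exists_smaller_cubes h hz hxy
    exact hz' (ih _ hlt h' rfl)
  · have hne : ¬ (x = 0 ∧ y = 0) := by
      rintro ⟨rfl, rfl⟩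
      simp at h
      exact hz h
    obtain ⟨p, hp, ⟨x, rfl⟩, ⟨y, rfl⟩⟩ : ∃ p : ℤ, Prime p ∧ p ∣ x ∧ p ∣ y := by
      by_contra! hcon
      exact hxy (isCoprime_of_prime_dvd hne hcon)
    have hpz : p ∣ z := by
      by_contra hpz
      have hcop : IsCoprime (p ^ 3) (z ^ 3) := (hp.coprime_iff_not_dvd.2 hpz).pow
      have h4 : p ^ 3 ∣ 4 :=
        hcop.dvd_of_dvd_mul_right ⟨x ^ 3 + y ^ 3, by linear_combination -h⟩
      have h4' := Nat.le_of_dvd (by norm_num) (Int.natAbs_dvd_natAbs.2 h4)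
      rw [Int.natAbs_pow] at h4'
      have := Nat.pow_le_pow_left (Int.prime_iff_natAbs_prime.1 hp).two_le 3
      simp only [Int.reduceAbs] at h4'
      omega
    obtain ⟨z, rfl⟩ := hpz
    have hz0 : z ≠ 0 := right_ne_zero_of_mul hz
    have h' : x ^ 3 + y ^ 3 = 4 * z ^ 3 := by
      apply mul_left_cancel₀ (pow_ne_zero 3 hp.ne_zero)
      linear_combination h
    refine hz0 (ih _ ?_ h' rfl)
    rw [Int.natAbs_mul]
    have := Int.natAbs_pos.2 hz0
    have := (Int.prime_iff_natAbs_prime.1 hp).two_le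
    nlinarith

theorem Rat.eq_zero_of_cube_add_cube {x y z : ℚ} (h : x ^ 3 + y ^ 3 = 4 * z ^ 3) : z = 0 := by
  have hnum : (x.num * y.den * z.den) ^ 3 + (y.num * x.den * z.den) ^ 3 =
      4 * (z.num * x.den * y.den) ^ 3 := by
    rw [← x.num_div_den, ← y.num_div_den, ← z.num_div_den] at h
    have hx : (x.den : ℚ) ≠ 0 := by exact_mod_cast x.den_ne_zero
    have hy : (y.den : ℚ) ≠ 0 := by exact_mod_cast y.den_ne_zero
    have hz : (z.den : ℚ) ≠ 0 := by exact_mod_cast z.den_ne_zero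
    field_simp at h
    have : ((x.num * y.den * z.den) ^ 3 + (y.num * x.den * z.den) ^ 3 : ℚ) =
      4 * (z.num * x.den * y.den) ^ 3 := by linear_combination h
    exact_mod_cast this
  simpa using _root_.eq_zero_of_cube_add_cube hnum

/-- The rational points on `y ^ 2 = x ^ 3 + 4`. -/
theorem eq_zero_of_sq_eq_cube_add_four {x y : ℚ} (h : y ^ 2 = x ^ 3 + 4) : x = 0 := by
  have := Rat.eq_zero_of_cube_add_cube (x := 18 * x ^ 3 + y * (x ^ 3 - 32))
    (y := 18 * x ^ 3 - y * (x ^ 3 - 32)) (z := 3 * x * (x ^ 3 + 16))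
    (by linear_combination 108 * x ^ 3 * (x ^ 3 - 32) ^ 2 * h)
  rcases mul_eq_zero.1 this with h' | h'
  · simpa using h'
  · nlinarith [sq_nonneg y]

/-- The value of `c` attached to the parameter `u`. -/
def periodFourParam {K : Type*} [Field K] (u : K) : K :=
  (u ^ 2 - 4 * u - 1) * (u ^ 4 + u ^ 3 + 2 * u ^ 2 - u + 1) / (4 * u * (u + 1) ^ 2 * (u - 1) ^ 2)

theorem hasExactPeriod_four_iff {K : Type*} [Field K] {c α : K} :
    HasExactPeriod c 4 α ↔ (fc c)^[4] α = α ∧ (fc c)^[2] α ≠ α := by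
  refine ⟨fun h => ⟨h.1, h.2 2 (by norm_num) (by norm_num)⟩, fun ⟨h4, h2⟩ => ⟨h4, ?_⟩⟩
  intro j hj hj4 h
  have hp : Function.IsPeriodicPt (fc c) j α := h
  interval_cases j
  · exact h2 (hp.const_mul 2)
  · exact h2 h
  · exact h2 ((show Function.IsPeriodicPt (fc c) 4 α from h4).sub hp |>.const_mul 2)

/-- The conditions on the parameters `u` and `v`. -/
structure IsPeriodFourPair {K : Type*} [Field K] (u v : K) : Prop where
  curve : v ^ 2 = -u * (u ^ 2 + 1) * (u ^ 2 - 2 * u - 1)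
  ne_zero : v * (u + 1) * (u - 1) ≠ 0

section

variable {K : Type*} [Field K] {u v c : K}

theorem IsPeriodFourPair.ne (h : IsPeriodFourPair u v) :
    u ≠ 0 ∧ v ≠ 0 ∧ u + 1 ≠ 0 ∧ u - 1 ≠ 0 := by
  have h0 := h.ne_zero
  have hv : v ≠ 0 := left_ne_zero_of_mul (left_ne_zero_of_mul h0)
  refine ⟨?_, hv, right_ne_zero_of_mul (left_ne_zero_of_mul h0), right_ne_zero_of_mul h0⟩
  rintro rfl
  have := h.curve
  simp at this
  exact hv this

theorem IsPeriodFourPair.neg (h : IsPeriodFourPair u v) : IsPeriodFourPair u (-v) :=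
  ⟨by rw [neg_sq, h.curve], by simpa using h.ne_zero⟩

variable [CharZero K]

theorem IsPeriodFourPair.fc_fst (h : IsPeriodFourPair u v) :
    fc (periodFourParam u) ((u - 1) / (2 * (u + 1)) + v / (2 * u * (u - 1))) =
      -(u + 1) / (2 * (u - 1)) + v / (2 * u * (u + 1)) := by
  obtain ⟨h0, -, h1, h2⟩ := h.ne
  unfold fc periodFourParam
  field_simp
  linear_combination 4 * (u + 1) ^ 2 * h.curve

theorem IsPeriodFourPair.fc_snd (h : IsPeriodFourPair u v) :
    fc (periodFourParam u) (-(u + 1) / (2 * (u - 1)) + v / (2 * u * (u + 1))) =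
      (u - 1) / (2 * (u + 1)) - v / (2 * u * (u - 1)) := by
  obtain ⟨h0, -, h1, h2⟩ := h.ne
  unfold fc periodFourParam
  field_simp
  linear_combination 4 * (u - 1) ^ 2 * h.curve

theorem IsPeriodFourPair.iterates (h : IsPeriodFourPair u v) (hc : c = periodFourParam u) {α : K}
    (hα : α = (u - 1) / (2 * (u + 1)) + v / (2 * u * (u - 1))) :
    fc c α = -(u + 1) / (2 * (u - 1)) + v / (2 * u * (u + 1)) ∧
    (fc c)^[2] α = (u - 1) / (2 * (u + 1)) - v / (2 * u * (u - 1)) ∧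
    (fc c)^[3] α = -(u + 1) / (2 * (u - 1)) - v / (2 * u * (u + 1)) ∧
    (fc c)^[4] α = α := by
  have e₁ := h.fc_fst
  have e₂ := h.fc_snd
  have e₃ := h.neg.fc_fst
  have e₄ := h.neg.fc_snd
  simp only [neg_div, ← sub_eq_add_neg, sub_neg_eq_add] at e₁ e₂ e₃ e₄ ⊢
  subst hc hα
  simp only [Function.iterate_succ, Function.iterate_zero, Function.comp_apply, id]
  rw [e₁, e₂, e₃, e₄]
  exact ⟨rfl, rfl, rfl, rfl⟩

theorem IsPeriodFourPair.hasExactPeriod (h : IsPeriodFourPair u v) (hc : c = periodFourParam u)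
    {α : K} (hα : α = (u - 1) / (2 * (u + 1)) + v / (2 * u * (u - 1))) :
    HasExactPeriod c 4 α := by
  obtain ⟨-, e₂, -, e₄⟩ := h.iterates hc hα
  refine hasExactPeriod_four_iff.2 ⟨e₄, ?_⟩
  rw [e₂, hα]
  obtain ⟨h0, hv, h1, h2⟩ := h.ne
  intro heq
  have : (u + 1) * v = 0 := by
    field_simp at heq
    linear_combination -heq / 2
  exact mul_ne_zero h1 hv this

theorem HasExactPeriod.exists_pair {α : K} (h : HasExactPeriod c 4 α) :
    ∃ u v : K, IsPeriodFourPair u v ∧ α = (u - 1) / (2 * (u + 1)) + v / (2 * u * (u - 1)) ∧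
      c = periodFourParam u := by
  obtain ⟨h4, h2⟩ := hasExactPeriod_four_iff.1 h
  obtain ⟨x₁, h₁⟩ : ∃ x, x = α ^ 2 + c := ⟨_, rfl⟩
  obtain ⟨x₂, h₂⟩ : ∃ x, x = x₁ ^ 2 + c := ⟨_, rfl⟩
  obtain ⟨x₃, h₃⟩ : ∃ x, x = x₂ ^ 2 + c := ⟨_, rfl⟩
  simp only [Function.iterate_succ, Function.iterate_zero, Function.comp_apply, id, fc, ← h₁, ← h₂,
    ← h₃] at h4 h2
  clear h
  obtain ⟨s, hs⟩ : ∃ s, s = α + x₂ := ⟨_, rfl⟩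
  obtain ⟨d, hd⟩ : ∃ d, d = α - x₂ := ⟨_, rfl⟩
  have hd0 : d ≠ 0 := by
    rw [hd]
    exact sub_ne_zero.2 (Ne.symm h2)
  have hdiff : x₁ - x₃ = d * s := by
    rw [h₁, h₃, hd, hs]
    ring
  have hsum : s * (x₁ + x₃) = -1 := by
    apply mul_left_cancel₀ hd0
    linear_combination -(x₁ + x₃) * hdiff - h₂ - h4 + hd
  have hs0 : s ≠ 0 := by
    rintro rfl
    simp at hsum
  obtain ⟨s', hs'⟩ : ∃ s', s' = x₁ + x₃ := ⟨_, rfl⟩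
  rw [← hs'] at hsum
  have E₁ : s ^ 2 + d ^ 2 + 4 * c = 2 * s' := by
    rw [hs', hs, hd]
    linear_combination -2 * h₁ - 2 * h₃
  have E₂ : s' ^ 2 + (d * s) ^ 2 + 4 * c = 2 * s := by
    rw [← hdiff, hs', hs]
    linear_combination -2 * h₂ + 2 * h4
  have hs2 : s ^ 2 ≠ 1 := by
    intro hs2
    have hss : s' = -s := by linear_combination s * hsum - s' * hs2
    have : 4 * s = 0 := by
      rw [hss] at E₁ E₂
      linear_combination E₁ - E₂ + d ^ 2 * hs2
    simp at this
    exact hs0 this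
  have hs1 : 1 - s ≠ 0 := by
    intro h
    exact hs2 (by linear_combination -(s + 1) * h)
  have hs1' : 1 + s ≠ 0 := by
    intro h
    exact hs2 (by linear_combination (s - 1) * h)
  have hkey : s ^ 2 * d ^ 2 * (1 - s ^ 2) = 1 - 2 * s - 2 * s ^ 3 - s ^ 4 := by
    linear_combination s ^ 2 * E₁ - s ^ 2 * E₂ + (s * s' - 1 + 2 * s) * hsum
  have hc : c = (2 * s' - s ^ 2 - d ^ 2) / 4 := by
    field_simp
    linear_combination E₁
  have hs'' : s' = -1 / s := by
    field_simp
    linear_combination hsum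
  have hu1 : (1 + s) / (1 - s) + 1 = 2 / (1 - s) := by
    field_simp
    ring
  have hu2 : (1 + s) / (1 - s) - 1 = 2 * s / (1 - s) := by
    field_simp
    ring
  have hv : d * ((1 + s) / (1 - s)) * ((1 + s) / (1 - s) - 1) =
      2 * d * s * (1 + s) / (1 - s) ^ 2 := by
    rw [hu2]
    field_simp
  refine ⟨(1 + s) / (1 - s), d * ((1 + s) / (1 - s)) * ((1 + s) / (1 - s) - 1), ⟨?_, ?_⟩, ?_, ?_⟩
  · rw [hv]
    field_simp
    linear_combination 4 * hkey
  · rw [hv, hu1, hu2]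
    simp [hd0, hs0, hs1, hs1']
  · rw [hu1, hu2]
    field_simp
    rw [hs, hd]
    ring
  · unfold periodFourParam
    rw [hu1, hu2, hc, hs'']
    field_simp
    linear_combination -16 * hkey

end

theorem eq_or_mul_eq_neg_one_of_periodFourParam_eq {q r : ℚ} (hq : q ≠ 0) (hq₁ : q + 1 ≠ 0)
    (hq₂ : q - 1 ≠ 0) (hr : r ≠ 0) (hr₁ : r + 1 ≠ 0) (hr₂ : r - 1 ≠ 0)
    (h : periodFourParam q = periodFourParam r) : r = q ∨ q * r = -1 := by
  have key : ∀ t : ℚ, t ≠ 0 → t + 1 ≠ 0 → t - 1 ≠ 0 → t - 1 / t ≠ 0 ∧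
      periodFourParam t = ((t - 1 / t) ^ 3 - 3 * (t - 1 / t) ^ 2 - 16) / (4 * (t - 1 / t) ^ 2) := by
    intro t h0 h1 h2
    have e : t - 1 / t = (t + 1) * (t - 1) / t := by
      field_simp
      ring
    rw [e]
    refine ⟨div_ne_zero (mul_ne_zero h1 h2) h0, ?_⟩
    unfold periodFourParam
    field_simp
    ring
  obtain ⟨hz, ez⟩ := key q hq hq₁ hq₂
  obtain ⟨hw, ew⟩ := key r hr hr₁ hr₂
  obtain ⟨z, hzdef⟩ : ∃ z, z = q - 1 / q := ⟨_, rfl⟩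
  obtain ⟨w, hwdef⟩ : ∃ w, w = r - 1 / r := ⟨_, rfl⟩
  rw [ez, ew] at h
  rw [← hzdef] at h hz
  rw [← hwdef] at h hw
  have hprod : (z - w) * (z ^ 2 * w ^ 2 + 16 * (z + w)) = 0 := by
    field_simp at h
    linear_combination h
  rcases mul_eq_zero.1 hprod with h1 | h1
  · have : (r - q) * (q * r + 1) = 0 := by
      rw [hzdef, hwdef] at h1
      field_simp at h1
      linear_combination -h1
    rcases mul_eq_zero.1 this with h2 | h2
    · exact Or.inl (sub_eq_zero.1 h2)
    · exact Or.inr (eq_neg_of_add_eq_zero_left h2)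
  · have := eq_zero_of_sq_eq_cube_add_four (x := -z) (y := (z ^ 2 * w + 8) / 4)
      (by linear_combination z ^ 2 / 16 * h1)
    exact absurd (neg_eq_zero.1 this) hz

theorem HasExactPeriod.map_fc {K : Type*} [Field K] {c α : K} (h : HasExactPeriod c 4 α) :
    HasExactPeriod c 4 (fc c α) := by
  rw [hasExactPeriod_four_iff] at h ⊢
  refine ⟨?_, fun h2 => h.2 ?_⟩
  · rw [← Function.iterate_succ_apply, Function.iterate_succ_apply', h.1]
  · have := congrArg (fc c)^[3] h2
    rw [← Function.iterate_succ_apply, ← Function.iterate_add_apply, ← Function.iterate_succ_apply,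
      h.1, show 3 + Nat.succ 2 = 2 + 4 from rfl, Function.iterate_add_apply, h.1] at this
    exact this

theorem HasExactPeriod.iterate_fc {K : Type*} [Field K] {c α : K} (h : HasExactPeriod c 4 α)
    (n : ℕ) : HasExactPeriod c 4 ((fc c)^[n] α) := by
  induction n with
  | zero => exact h
  | succ n ih =>
    rw [Function.iterate_succ_apply']
    exact ih.map_fc

section

variable {K : Type*} [Field K] [CharZero K] {u v c : K}

/-- The parameters `u` of two period four points for the same `c` agree up to `u ↦ -1 / u`. -/
theorem IsPeriodFourPair.eq_or_mul_eq_neg_one (hdeg : Module.finrank ℚ K = 2)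
    (h : IsPeriodFourPair u v) {u' v' : K} (h' : IsPeriodFourPair u' v')
    (hc : periodFourParam u = periodFourParam u') : u' = u ∨ u * u' = -1 := by
  obtain ⟨h0, hv, h1, h2⟩ := h.ne
  obtain ⟨h0', hv', h1', h2'⟩ := h'.ne
  obtain ⟨q, rfl⟩ := exists_ratCast_eq_of_curve hdeg h.curve hv
  obtain ⟨r, rfl⟩ := exists_ratCast_eq_of_curve hdeg h'.curve hv'
  unfold periodFourParam at hc
  norm_cast at h0 h1 h2 h0' h1' h2' hc
  have := eq_or_mul_eq_neg_one_of_periodFourParam_eq h0 h1 h2 h0' h1' h2' hc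
  exact_mod_cast this

theorem IsPeriodFourPair.eq_iterate (hdeg : Module.finrank ℚ K = 2)
    (h : IsPeriodFourPair u v) (hc : c = periodFourParam u) {α β : K}
    (hα : α = (u - 1) / (2 * (u + 1)) + v / (2 * u * (u - 1))) (hβ : HasExactPeriod c 4 β) :
    β = α ∨ β = fc c α ∨ β = (fc c)^[2] α ∨ β = (fc c)^[3] α := by
  obtain ⟨e₁, e₂, e₃, -⟩ := h.iterates hc hα
  obtain ⟨u', v', h', rfl, hc'⟩ := hβ.exists_pair
  obtain ⟨h0, hv, h1, h2⟩ := h.ne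
  rw [e₁, e₂, e₃, hα]
  rcases h.eq_or_mul_eq_neg_one hdeg h' (hc.symm.trans hc') with rfl | hu
  · rcases sq_eq_sq_iff_eq_or_eq_neg.1 (h'.curve.trans h.curve.symm) with rfl | rfl
    · exact Or.inl rfl
    · refine Or.inr (Or.inr (Or.inl ?_))
      ring
  · obtain rfl : u' = -1 / u := by
      field_simp
      linear_combination hu
    have hv' : v' ^ 2 = (v / u ^ 3) ^ 2 := by
      rw [h'.curve, div_pow v, h.curve]
      field_simp
      ring
    have a₁ : -1 / u + 1 = (u - 1) / u := by
      field_simp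
      ring
    have a₂ : -1 / u - 1 = -(u + 1) / u := by
      field_simp
      ring
    rw [a₁, a₂]
    rcases sq_eq_sq_iff_eq_or_eq_neg.1 hv' with rfl | rfl
    · refine Or.inr (Or.inl ?_)
      field_simp
    · refine Or.inr (Or.inr (Or.inr ?_))
      field_simp
      ring

theorem IsPeriodFourPair.map_eq (hdeg : Module.finrank ℚ K = 2) (h : IsPeriodFourPair u v)
    {σ : K ≃ₐ[ℚ] K} (hσ : σ ≠ AlgEquiv.refl) : σ u = u ∧ σ v = -v := by
  obtain ⟨h0, hv, h1, h2⟩ := h.ne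
  obtain ⟨q, rfl⟩ := exists_ratCast_eq_of_curve hdeg h.curve hv
  have hvirr : ∀ r : ℚ, (r : K) ≠ v := by
    rintro r rfl
    have hcurve := h.curve
    norm_cast at h0 h1 h2 hcurve
    rcases rational_points hcurve with rfl | rfl | rfl
    · exact h0 rfl
    · exact h2 (sub_self 1)
    · exact h1 (by norm_num)
  refine ⟨map_ratCast σ q, ?_⟩
  have hsq : (σ v) ^ 2 = v ^ 2 := by
    rw [← map_pow, h.curve]
    simp [map_ofNat]
  refine (sq_eq_sq_iff_eq_or_eq_neg.1 hsq).resolve_left fun hfix => hσ ?_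
  ext w
  obtain ⟨a, b, rfl⟩ := exists_eq_mul_add hdeg hvirr w
  simp [hfix]

end

theorem HasExactPeriod.iterate_ne {K : Type*} [Field K] {c α : K} (h : HasExactPeriod c 4 α) :
    α ≠ fc c α ∧ α ≠ (fc c)^[2] α ∧ α ≠ (fc c)^[3] α ∧
      fc c α ≠ (fc c)^[2] α ∧ fc c α ≠ (fc c)^[3] α ∧ (fc c)^[2] α ≠ (fc c)^[3] α :=
  ⟨(h.2 1 (by norm_num) (by norm_num)).symm, (h.2 2 (by norm_num) (by norm_num)).symm,
    (h.2 3 (by norm_num) (by norm_num)).symm,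
    (h.map_fc.2 1 (by norm_num) (by norm_num)).symm,
    (h.map_fc.2 2 (by norm_num) (by norm_num)).symm,
    ((h.iterate_fc 2).2 1 (by norm_num) (by norm_num)).symm⟩

theorem period_four_parametrization {K : Type*} [Field K] [NumberField K]
    (hdeg : Module.finrank ℚ K = 2) (c : K) :
    (∀ α : K, HasExactPeriod c 4 α ↔
      ∃ u v : K,
        v ^ 2 = -u * (u ^ 2 + 1) * (u ^ 2 - 2 * u - 1) ∧
        v * (u + 1) * (u - 1) ≠ 0 ∧
        α = (u - 1) / (2 * (u + 1)) + v / (2 * u * (u - 1)) ∧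
        c = (u ^ 2 - 4 * u - 1) * (u ^ 4 + u ^ 3 + 2 * u ^ 2 - u + 1) /
            (4 * u * (u + 1) ^ 2 * (u - 1) ^ 2)) ∧
    (∀ u v : K,
      v ^ 2 = -u * (u ^ 2 + 1) * (u ^ 2 - 2 * u - 1) →
      v * (u + 1) * (u - 1) ≠ 0 →
      c = (u ^ 2 - 4 * u - 1) * (u ^ 4 + u ^ 3 + 2 * u ^ 2 - u + 1) /
          (4 * u * (u + 1) ^ 2 * (u - 1) ^ 2) →
      ∀ α : K, α = (u - 1) / (2 * (u + 1)) + v / (2 * u * (u - 1)) →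
        ({β : K | HasExactPeriod c 4 β} = {α, fc c α, (fc c)^[2] α, (fc c)^[3] α} ∧
          α ≠ fc c α ∧ α ≠ (fc c)^[2] α ∧ α ≠ (fc c)^[3] α ∧
          fc c α ≠ (fc c)^[2] α ∧ fc c α ≠ (fc c)^[3] α ∧
          (fc c)^[2] α ≠ (fc c)^[3] α) ∧
        fc c α = -(u + 1) / (2 * (u - 1)) + v / (2 * u * (u + 1)) ∧
        (fc c)^[2] α = (u - 1) / (2 * (u + 1)) - v / (2 * u * (u - 1)) ∧
        (fc c)^[3] α = -(u + 1) / (2 * (u - 1)) - v / (2 * u * (u + 1)) ∧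
        (∃ q : ℚ, (q : K) = c) ∧
        (∀ σ : K ≃ₐ[ℚ] K, σ ≠ AlgEquiv.refl → σ α = (fc c)^[2] α)) := by
  refine ⟨fun α => ⟨fun h => ?_, fun ⟨u, v, h₁, h₂, hα, hc⟩ =>
    IsPeriodFourPair.hasExactPeriod ⟨h₁, h₂⟩ hc hα⟩, fun u v h₁ h₂ hc α hα => ?_⟩
  · obtain ⟨u, v, h, hα, hc⟩ := h.exists_pair
    exact ⟨u, v, h.curve, h.ne_zero, hα, hc⟩
  have h : IsPeriodFourPair u v := ⟨h₁, h₂⟩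
  have hper := h.hasExactPeriod hc hα
  obtain ⟨e₁, e₂, e₃, -⟩ := h.iterates hc hα
  refine ⟨⟨?_, hper.iterate_ne⟩, e₁, e₂, e₃, ?_, fun σ hσ => ?_⟩
  · ext β
    simp only [Set.mem_ofPred_eq, Set.mem_insert_iff, Set.mem_singleton_iff]
    refine ⟨h.eq_iterate hdeg hc hα, ?_⟩
    rintro (rfl | rfl | rfl | rfl)
    · exact hper
    · exact hper.map_fc
    · exact hper.iterate_fc 2
    · exact hper.iterate_fc 3
  · obtain ⟨q, rfl⟩ := exists_ratCast_eq_of_curve hdeg h.curve h.ne.2.1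
    refine ⟨periodFourParam q, ?_⟩
    rw [hc, periodFourParam]
    push_cast
    rfl
  · obtain ⟨hu, hv⟩ := h.map_eq hdeg hσ
    rw [e₂, hα]
    simp only [map_add, map_sub, map_div₀, map_mul, map_one, map_ofNat, hu, hv]
    ring
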